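/- arXiv:1803.03016 — 2 statements merged into one kernel-verified Lean document; each statement's English description precedes it below -/
import Mathlib

section
/- If U : [0,∞) → ℝ is a continuous solution of the Volterra equation U(η)^{m+1} = 1 + (m+1)[ -βη + ∫₀^η ((1-α/2)η - z) I^{0,1-α}_{-2/α} U(z) dz ], and U > 0 on an interval where the equation holds, then U is twice continuously differentiable there and satisfies (U^m U')' = (1-α) I^{0,1-α}_{-2/α} U(η) − (α/2) η (d/dη) I^{0,1-α}_{-2/α} U(η), with U(0) = 1 and U'(0) = −β. -/
open Real

/-- The Erdélyi–Kober operator I^{0,1-α}_{-2/α}. -/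
noncomputable def EK (α : ℝ) (W : ℝ → ℝ) (η : ℝ) : ℝ :=
  (1 / Real.Gamma (1 - α)) * ∫ s in (0:ℝ)..1, (1 - s) ^ (-α) * W (s ^ (-(α / 2)) * η)

open MeasureTheory Set Filter Topology

lemma intervalIntegrable_one_sub_rpow {p : ℝ} (hp : -1 < p) (a b : ℝ) :
    IntervalIntegrable (fun s : ℝ => (1 - s) ^ p) volume a b := by
  have h := (intervalIntegral.intervalIntegrable_rpow' (a := 1 - a) (b := 1 - b) hp).comp_sub_left 1
  simpa using h

lemma intervalIntegrable_one_sub_rpow_mul_rpow {p q : ℝ} (hp : -1 < p) (hq : -1 < q) :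
    IntervalIntegrable (fun s : ℝ => (1 - s) ^ p * s ^ q) volume 0 1 := by
  apply IntervalIntegrable.trans (b := 1 / 2)
  · apply (intervalIntegral.intervalIntegrable_rpow' hq).continuousOn_mul
    apply ContinuousOn.rpow_const (by fun_prop)
    intro x hx
    rw [uIcc_of_le (by norm_num)] at hx
    left; linarith [hx.2]
  · apply (intervalIntegrable_one_sub_rpow hp _ _).mul_continuousOn
    apply ContinuousOn.rpow_const (by fun_prop)
    intro x hx
    rw [uIcc_of_le (by norm_num)] at hx
    left; linarith [hx.1]

lemma continuous_integral_mul_comp_of_bounded {k r g : ℝ → ℝ} {C : ℝ}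
    (hk : IntervalIntegrable k volume 0 1) (hr : Measurable r) (hg : Continuous g)
    (hC : ∀ x, |g x| ≤ C) :
    Continuous fun x => ∫ s in (0:ℝ)..1, k s * g (r s * x) := by
  refine intervalIntegral.continuous_of_dominated_interval (bound := fun s => |k s| * C)
    ?_ ?_ (hk.abs.mul_const C) ?_
  · intro x
    exact hk.def'.aestronglyMeasurable.mul
      (hg.measurable.comp (hr.mul_const x)).aestronglyMeasurable
  · intro x
    refine Eventually.of_forall fun s _ => ?_
    rw [norm_mul, Real.norm_eq_abs, Real.norm_eq_abs]
    exact mul_le_mul_of_nonneg_left (hC _) (abs_nonneg _)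
  · exact Eventually.of_forall fun s _ => by fun_prop

lemma measurable_rpow_exponent (q : ℝ) : Measurable fun s : ℝ => s ^ q := by fun_prop

lemma abs_le_of_hasDerivAt {V g : ℝ → ℝ} {C : ℝ} (hV : ∀ x, HasDerivAt V (g x) x)
    (hC : ∀ x, |g x| ≤ C) (x : ℝ) : |V x| ≤ |V 0| + C * |x| := by
  have h := convex_univ.norm_image_sub_le_of_norm_hasDerivWithin_le (f := V) (f' := g) (C := C)
    (fun y _ => (hV y).hasDerivWithinAt) (fun y _ => hC y) (mem_univ 0) (mem_univ x)
  rw [Real.norm_eq_abs, Real.norm_eq_abs, sub_zero] at h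
  have := abs_sub_abs_le_abs_sub (V x) (V 0)
  linarith

section Kernel

variable {α : ℝ}

lemma intervalIntegrable_kernel_mul_of_linear_growth (hα : 0 < α) (hα1 : α < 1) {V : ℝ → ℝ}
    {A C : ℝ} (hV : Continuous V) (hb : ∀ x, |V x| ≤ A + C * |x|) (x : ℝ) :
    IntervalIntegrable (fun s : ℝ => (1 - s) ^ (-α) * V (s ^ (-(α / 2)) * x)) volume 0 1 := by
  have h1 := intervalIntegrable_one_sub_rpow (p := -α) (by linarith) 0 1
  have h2 := intervalIntegrable_one_sub_rpow_mul_rpow (p := -α) (q := -(α / 2))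
    (by linarith) (by linarith)
  refine IntervalIntegrable.mono_fun' ((h1.mul_const A).add (h2.mul_const (C * |x|))) ?_ ?_
  · exact h1.def'.aestronglyMeasurable.mul
      (hV.measurable.comp ((measurable_rpow_exponent _).mul_const x)).aestronglyMeasurable
  · refine (ae_restrict_mem measurableSet_uIoc).mono fun s hs => ?_
    rw [uIoc_of_le zero_le_one] at hs
    have hk : 0 ≤ (1 - s) ^ (-α) := rpow_nonneg (by linarith [hs.2]) _
    have hr : 0 ≤ s ^ (-(α / 2)) := rpow_nonneg hs.1.le _
    have := mul_le_mul_of_nonneg_left (hb (s ^ (-(α / 2)) * x)) hk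
    rw [abs_mul, abs_of_nonneg hr] at this
    simp only [norm_mul, Real.norm_eq_abs, abs_of_nonneg hk]
    linarith

lemma intervalIntegrable_comp_rpow_of_linear_growth (hα1 : α < 1) {V : ℝ → ℝ}
    {A C : ℝ} (hV : Continuous V) (hb : ∀ x, |V x| ≤ A + C * |x|) {T : ℝ} (hT : 0 ≤ T) :
    IntervalIntegrable (fun w : ℝ => V (w ^ (-(α / 2)))) volume 0 T := by
  have h2 := intervalIntegral.intervalIntegrable_rpow' (r := -(α / 2)) (a := 0) (b := T)
    (by linarith)
  refine IntervalIntegrable.mono_fun'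
    ((intervalIntegrable_const (c := A)).add (h2.const_mul C)) ?_ ?_
  · exact (hV.measurable.comp (measurable_rpow_exponent _)).aestronglyMeasurable
  · refine (ae_restrict_mem measurableSet_uIoc).mono fun s hs => ?_
    rw [uIoc_of_le hT] at hs
    have hr : 0 ≤ s ^ (-(α / 2)) := rpow_nonneg hs.1.le _
    have := hb (s ^ (-(α / 2)))
    rw [abs_of_nonneg hr] at this
    simpa using this

lemma EK_continuous_of_bounded (hα1 : α < 1) {V : ℝ → ℝ} {C : ℝ}
    (hV : Continuous V) (hC : ∀ x, |V x| ≤ C) : Continuous (EK α V) :=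
  (continuous_integral_mul_comp_of_bounded
    (intervalIntegrable_one_sub_rpow (p := -α) (by linarith) 0 1)
    (measurable_rpow_exponent _) hV hC).const_mul _

lemma EK_contDiff_of_bounded_deriv (hα : 0 < α) (hα1 : α < 1) {V g : ℝ → ℝ} {C : ℝ}
    (hV : ∀ x, HasDerivAt V (g x) x) (hg : Continuous g) (hC : ∀ x, |g x| ≤ C) :
    ContDiff ℝ 1 (EK α V) := by
  have hVc : Continuous V := continuous_iff_continuousAt.2 fun x => (hV x).continuousAt
  have hk := intervalIntegrable_one_sub_rpow_mul_rpow (p := -α) (q := -(α / 2))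
    (by linarith) (by linarith)
  have hd : ∀ x, HasDerivAt (fun x => ∫ s in (0:ℝ)..1, (1 - s) ^ (-α) * V (s ^ (-(α / 2)) * x))
      (∫ s in (0:ℝ)..1, (1 - s) ^ (-α) * s ^ (-(α / 2)) * g (s ^ (-(α / 2)) * x)) x := by
    intro x
    refine (intervalIntegral.hasDerivAt_integral_of_dominated_loc_of_deriv_le
      (F := fun x s => (1 - s) ^ (-α) * V (s ^ (-(α / 2)) * x))
      (F' := fun x s => (1 - s) ^ (-α) * s ^ (-(α / 2)) * g (s ^ (-(α / 2)) * x))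
      (bound := fun s => |(1 - s) ^ (-α) * s ^ (-(α / 2))| * C)
      univ_mem ?_ ?_ ?_ ?_ (hk.abs.mul_const C) ?_).2
    · exact Eventually.of_forall fun y => (intervalIntegrable_kernel_mul_of_linear_growth hα hα1
        hVc (abs_le_of_hasDerivAt hV hC) y).def'.aestronglyMeasurable
    · exact intervalIntegrable_kernel_mul_of_linear_growth hα hα1
        hVc (abs_le_of_hasDerivAt hV hC) x
    · exact hk.def'.aestronglyMeasurable.mul
        (hg.measurable.comp ((measurable_rpow_exponent _).mul_const x)).aestronglyMeasurable
    · refine Eventually.of_forall fun s _ y _ => ?_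
      rw [norm_mul, Real.norm_eq_abs, Real.norm_eq_abs]
      exact mul_le_mul_of_nonneg_left (hC _) (abs_nonneg _)
    · refine Eventually.of_forall fun s _ y _ => ?_
      have h := ((hV (s ^ (-(α / 2)) * y)).comp y
        ((hasDerivAt_id y).const_mul (s ^ (-(α / 2))))).const_mul ((1 - s) ^ (-α))
      refine h.congr_deriv ?_
      ring
  have hd' : ∀ x, HasDerivAt (EK α V) (1 / Real.Gamma (1 - α) *
      ∫ s in (0:ℝ)..1, (1 - s) ^ (-α) * s ^ (-(α / 2)) * g (s ^ (-(α / 2)) * x)) x :=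
    fun x => (hd x).const_mul _
  rw [contDiff_one_iff_deriv]
  refine ⟨fun x => (hd' x).differentiableAt, ?_⟩
  rw [funext fun x => (hd' x).deriv]
  exact (continuous_integral_mul_comp_of_bounded hk (measurable_rpow_exponent _) hg hC).const_mul _

end Kernel

lemma hasDerivAt_integral_one_sub_mul_rpow {T k : ℝ} (hT : 0 < T) (hk : 0 < k) {φ : ℝ → ℝ}
    (hφ : IntervalIntegrable φ volume 0 T) {t : ℝ} (ht : t < 1 / T) :
    HasDerivAt (fun t => ∫ w in (0:ℝ)..T, (1 - t * w) ^ (-k) * φ w)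
      (∫ w in (0:ℝ)..T, (1 - t * w) ^ (-(k + 1)) * (k * w * φ w)) t := by
  obtain ⟨u, htu, huT⟩ := exists_between ht
  have hu : 0 < 1 - u * T := by
    rw [lt_div_iff₀ hT] at huT; linarith
  obtain ⟨δ, hδ, hδ1, hδu⟩ : ∃ δ > 0, δ ≤ 1 ∧ δ ≤ 1 - u * T :=
    ⟨min 1 (1 - u * T), by positivity, min_le_left _ _, min_le_right _ _⟩
  have hlow : ∀ y ≤ u, ∀ w ∈ Icc 0 T, δ ≤ 1 - y * w := by
    intro y hy w hw
    have h1 : y * w ≤ u * w := mul_le_mul_of_nonneg_right hy hw.1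
    rcases le_total 0 u with h | h
    · nlinarith [mul_le_mul_of_nonneg_left hw.2 h]
    · nlinarith [mul_nonneg_of_nonpos_of_nonpos h (neg_nonpos.2 hw.1)]
  have hcont : ∀ p : ℝ, ∀ y ≤ u, ContinuousOn (fun w => (1 - y * w) ^ p) (uIcc 0 T) := by
    intro p y hy
    apply ContinuousOn.rpow_const (by fun_prop)
    intro w hw
    rw [uIcc_of_le hT.le] at hw
    left; linarith [hlow y hy w hw]
  have hφ' : IntervalIntegrable (fun w => k * w * φ w) volume 0 T :=
    hφ.continuousOn_mul (by fun_prop)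
  refine (intervalIntegral.hasDerivAt_integral_of_dominated_loc_of_deriv_le
    (F := fun t w => (1 - t * w) ^ (-k) * φ w)
    (F' := fun t w => (1 - t * w) ^ (-(k + 1)) * (k * w * φ w))
    (bound := fun w => δ ^ (-(k + 1)) * |k * w * φ w|)
    (Iio_mem_nhds htu) ?_ ?_ ?_ ?_ (hφ'.abs.const_mul _) ?_).2
  · filter_upwards [Iio_mem_nhds htu] with y hy
    exact (hφ.continuousOn_mul (hcont _ y (le_of_lt hy))).def'.aestronglyMeasurable
  · exact hφ.continuousOn_mul (hcont _ t htu.le)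
  · exact (hφ'.continuousOn_mul (hcont _ t htu.le)).def'.aestronglyMeasurable
  · refine Eventually.of_forall fun w hw y hy => ?_
    rw [uIoc_of_le hT.le] at hw
    have h := hlow y (le_of_lt hy) w (Ioc_subset_Icc_self hw)
    rw [norm_mul, Real.norm_eq_abs, Real.norm_eq_abs, abs_of_nonneg (rpow_nonneg (by linarith) _)]
    exact mul_le_mul_of_nonneg_right
      (rpow_le_rpow_of_nonpos hδ h (by linarith)) (abs_nonneg _)
  · refine Eventually.of_forall fun w hw y hy => ?_
    rw [uIoc_of_le hT.le] at hw
    have h := hlow y (le_of_lt hy) w (Ioc_subset_Icc_self hw)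
    have h1 : HasDerivAt (fun y => 1 - y * w) (-w) y := by
      simpa using ((hasDerivAt_id y).mul_const w).const_sub 1
    have h2 := (h1.rpow_const (p := -k) (Or.inl (by linarith))).mul_const (φ w)
    refine h2.congr_deriv ?_
    rw [show -(k + 1) = -k - 1 by ring]
    ring

lemma contDiffOn_integral_one_sub_mul_rpow {T k : ℝ} (hT : 0 < T) (hk : 0 < k) {φ : ℝ → ℝ}
    (hφ : IntervalIntegrable φ volume 0 T) :
    ContDiffOn ℝ 1 (fun t => ∫ w in (0:ℝ)..T, (1 - t * w) ^ (-k) * φ w) (Iio (1 / T)) := by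
  rw [contDiffOn_one_iff_derivWithin isOpen_Iio.uniqueDiffOn]
  refine ⟨fun t ht => (hasDerivAt_integral_one_sub_mul_rpow hT hk hφ ht).differentiableAt
    |>.differentiableWithinAt, ?_⟩
  have hφ' : IntervalIntegrable (fun w => k * w * φ w) volume 0 T :=
    hφ.continuousOn_mul (by fun_prop)
  refine ContinuousOn.congr (f := fun t => ∫ w in (0:ℝ)..T, (1 - t * w) ^ (-(k + 1)) *
    (k * w * φ w)) (fun t ht => ?_) fun t ht => ?_
  · exact (hasDerivAt_integral_one_sub_mul_rpow hT (by linarith) hφ' ht).continuousAt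
      |>.continuousWithinAt
  · exact (hasDerivAt_integral_one_sub_mul_rpow hT hk hφ ht).hasDerivWithinAt.derivWithin
      (isOpen_Iio.uniqueDiffWithinAt ht)

section Scaling

variable {α : ℝ} {W : ℝ → ℝ}

lemma rpow_mul_scale (hα : 0 < α) {η w : ℝ} (hη : 0 < η) (hw : 0 ≤ w) :
    (η ^ (2 / α) * w) ^ (-(α / 2)) * η = w ^ (-(α / 2)) := by
  rw [mul_rpow (rpow_nonneg hη.le _) hw, ← rpow_mul hη.le,
    show 2 / α * -(α / 2) = -1 by field_simp, rpow_neg_one]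
  field_simp

lemma eqOn_kernel_scale (hα : 0 < α) {η : ℝ} (hη : 0 < η) :
    EqOn (fun w => (1 - η ^ (2 / α) * w) ^ (-α) * W ((η ^ (2 / α) * w) ^ (-(α / 2)) * η))
      (fun w => (1 - η ^ (2 / α) * w) ^ (-α) * W (w ^ (-(α / 2)))) (Ici 0) := by
  intro w hw
  simp only [rpow_mul_scale hα hη hw]

lemma intervalIntegrable_kernel_scale_iff (hα : 0 < α) {η : ℝ} (hη : 0 < η) :
    IntervalIntegrable (fun s : ℝ => (1 - s) ^ (-α) * W (s ^ (-(α / 2)) * η)) volume 0 1 ↔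
      IntervalIntegrable (fun w => (1 - η ^ (2 / α) * w) ^ (-α) * W (w ^ (-(α / 2))))
        volume 0 (1 / η ^ (2 / α)) := by
  have ht : 0 < η ^ (2 / α) := rpow_pos_of_pos hη _
  have h := IntervalIntegrable.comp_mul_left_iff
    (f := fun s : ℝ => (1 - s) ^ (-α) * W (s ^ (-(α / 2)) * η)) (a := 0) (b := 1) ht.ne'
  rw [← h, zero_div]
  have hsub : uIoc 0 (1 / η ^ (2 / α)) ⊆ Ici 0 := by
    rw [uIoc_of_le (by positivity)]
    exact fun w hw => hw.1.le
  exact ⟨IntervalIntegrable.congr ((eqOn_kernel_scale hα hη).mono hsub),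
    IntervalIntegrable.congr ((eqOn_kernel_scale hα hη).mono hsub).symm⟩

lemma integral_kernel_scale (hα : 0 < α) {η : ℝ} (hη : 0 < η) :
    ∫ s in (0:ℝ)..1, (1 - s) ^ (-α) * W (s ^ (-(α / 2)) * η) =
      η ^ (2 / α) * ∫ w in (0:ℝ)..(1 / η ^ (2 / α)),
        (1 - η ^ (2 / α) * w) ^ (-α) * W (w ^ (-(α / 2))) := by
  have ht : 0 < η ^ (2 / α) := rpow_pos_of_pos hη _
  have h := intervalIntegral.mul_integral_comp_mul_left (a := 0) (b := 1 / η ^ (2 / α))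
    (f := fun s : ℝ => (1 - s) ^ (-α) * W (s ^ (-(α / 2)) * η)) (η ^ (2 / α))
  rw [mul_zero, mul_one_div_cancel ht.ne'] at h
  rw [← h]
  congr 1
  apply intervalIntegral.integral_congr
  rw [uIcc_of_le (by positivity)]
  exact (eqOn_kernel_scale hα hη).mono fun w hw => hw.1

lemma intervalIntegrable_comp_rpow_extend (hW : Continuous W) {ε T : ℝ} (hε : 0 < ε) (hT : 0 < T)
    (h : IntervalIntegrable (fun w : ℝ => W (w ^ (-(α / 2)))) volume 0 ε) :
    IntervalIntegrable (fun w : ℝ => W (w ^ (-(α / 2)))) volume 0 T := by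
  refine h.trans (ContinuousOn.intervalIntegrable ?_)
  refine hW.comp_continuousOn (ContinuousOn.rpow_const continuousOn_id fun w hw => Or.inl ?_)
  exact ((lt_min hε hT).trans_le hw.1).ne'

lemma intervalIntegrable_comp_rpow_of_kernel (hα : 0 < α) (hW : Continuous W) {η : ℝ} (hη : 0 < η)
    (h : IntervalIntegrable (fun s : ℝ => (1 - s) ^ (-α) * W (s ^ (-(α / 2)) * η)) volume 0 1) :
    IntervalIntegrable (fun w : ℝ => W (w ^ (-(α / 2)))) volume 0 1 := by
  have ht : 0 < η ^ (2 / α) := rpow_pos_of_pos hη _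
  rw [intervalIntegrable_kernel_scale_iff hα hη] at h
  set t := η ^ (2 / α)
  have hε : 0 < 1 / (2 * t) := by positivity
  refine intervalIntegrable_comp_rpow_extend hW hε one_pos ?_
  have hle : 1 / (2 * t) ≤ 1 / t := one_div_le_one_div_of_le ht (by linarith)
  have h' := h.mono_set (c := 0) (d := 1 / (2 * t)) (by
    rw [uIcc_of_le hε.le, uIcc_of_le (by positivity)]
    exact Icc_subset_Icc_right hle)
  have h2 := h'.continuousOn_mul (g := fun w => (1 - t * w) ^ α)
    (ContinuousOn.rpow_const (by fun_prop) fun w _ => Or.inr hα.le)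
  refine h2.congr fun w hw => ?_
  rw [uIoc_of_le hε.le] at hw
  have h1 : 0 < 1 - t * w := by
    have := (le_div_iff₀ (by positivity)).1 hw.2
    nlinarith
  rw [← mul_assoc, ← rpow_add h1, add_neg_cancel, rpow_zero, one_mul]

lemma comp_rpow_eq_zero (hα : 0 < α) {c : ℝ} (hc : 0 < c) (hW : ∀ z ∈ Icc 0 c, W z = 0)
    {w : ℝ} (hw : c ^ (-(2 / α)) ≤ w) : W (w ^ (-(α / 2))) = 0 := by
  have hT : 0 < c ^ (-(2 / α)) := rpow_pos_of_pos hc _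
  refine hW _ ⟨rpow_nonneg (hT.le.trans hw) _, ?_⟩
  refine (rpow_le_rpow_of_nonpos hT hw (by linarith)).trans_eq ?_
  rw [← rpow_mul hc.le, show -(2 / α) * -(α / 2) = 1 by field_simp, rpow_one]

lemma rpow_lt_one_div (hα : 0 < α) {c η : ℝ} (hc : 0 < c) (hη : 0 ≤ η) (hηc : η < c) :
    η ^ (2 / α) < 1 / c ^ (-(2 / α)) := by
  rw [rpow_neg hc.le, one_div, inv_inv]
  exact rpow_lt_rpow hη hηc (by positivity)

lemma EK_eq_of_eq_zero (hα : 0 < α) {c : ℝ} (hW : ∀ z ∈ Icc 0 c, W z = 0)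
    {η : ℝ} (hη : η ∈ Ico 0 c) :
    EK α W η = 1 / Real.Gamma (1 - α) * (η ^ (2 / α) * ∫ w in (0:ℝ)..(c ^ (-(2 / α))),
        (1 - η ^ (2 / α) * w) ^ (-α) * W (w ^ (-(α / 2)))) := by
  have hc : 0 < c := hη.1.trans_lt hη.2
  unfold EK
  congr 1
  rcases hη.1.eq_or_lt with rfl | h0
  · have h2 : (0:ℝ) ^ (2 / α) = 0 := zero_rpow (by positivity)
    simp [h2, hW 0 ⟨le_rfl, hc.le⟩]
  rw [integral_kernel_scale hα h0]
  congr 1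
  have hT : 0 < c ^ (-(2 / α)) := rpow_pos_of_pos hc _
  have ht : 0 < η ^ (2 / α) := rpow_pos_of_pos h0 _
  have hle : c ^ (-(2 / α)) ≤ 1 / η ^ (2 / α) := by
    rw [le_one_div hT ht]
    exact (rpow_lt_one_div hα hc hη.1 hη.2).le
  rw [intervalIntegral.integral_of_le (by positivity), intervalIntegral.integral_of_le hT.le]
  refine setIntegral_eq_of_subset_of_forall_sdiff_eq_zero measurableSet_Ioc
    (Ioc_subset_Ioc_right hle) fun w hw => ?_
  have hw' : c ^ (-(2 / α)) ≤ w := by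
    by_contra! hlt
    exact hw.2 ⟨hw.1.1, hlt.le⟩
  rw [comp_rpow_eq_zero hα hc hW hw', mul_zero]

lemma intervalIntegrable_kernel_of_eq_zero (hα : 0 < α) {c : ℝ}
    (hW : ∀ z ∈ Icc 0 c, W z = 0)
    (hφ : IntervalIntegrable (fun w : ℝ => W (w ^ (-(α / 2)))) volume 0 (c ^ (-(2 / α))))
    {η : ℝ} (hη : η ∈ Ico 0 c) :
    IntervalIntegrable (fun s : ℝ => (1 - s) ^ (-α) * W (s ^ (-(α / 2)) * η)) volume 0 1 := by
  have hc : 0 < c := hη.1.trans_lt hη.2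
  rcases hη.1.eq_or_lt with rfl | h0
  · simp [hW 0 ⟨le_rfl, hc.le⟩]
  rw [intervalIntegrable_kernel_scale_iff hα h0]
  have hT : 0 < c ^ (-(2 / α)) := rpow_pos_of_pos hc _
  have ht : 0 < η ^ (2 / α) := rpow_pos_of_pos h0 _
  have hlt := rpow_lt_one_div hα hc hη.1 hη.2
  rw [lt_div_iff₀ hT] at hlt
  refine IntervalIntegrable.trans (b := c ^ (-(2 / α))) ?_ ?_
  · refine hφ.continuousOn_mul (ContinuousOn.rpow_const (by fun_prop) fun w hw => Or.inl ?_)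
    rw [uIcc_of_le hT.le] at hw
    have := mul_le_mul_of_nonneg_left hw.2 ht.le
    linarith
  · have hle : c ^ (-(2 / α)) ≤ 1 / η ^ (2 / α) := by
      rw [le_div_iff₀ ht]; linarith
    refine (intervalIntegrable_const (c := (0:ℝ))).congr fun w hw => ?_
    rw [uIoc_of_le hle] at hw
    simp only [comp_rpow_eq_zero hα hc hW hw.1.le, mul_zero]

lemma EK_contDiffOn_of_eq_zero (hα : 0 < α) (hα1 : α < 1) {c : ℝ} (hc : 0 < c)
    (hW : ∀ z ∈ Icc 0 c, W z = 0)
    (hφ : IntervalIntegrable (fun w : ℝ => W (w ^ (-(α / 2)))) volume 0 (c ^ (-(2 / α)))) :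
    ContDiffOn ℝ 1 (EK α W) (Ico 0 c) := by
  have hp : ContDiff ℝ 1 fun η : ℝ => η ^ (2 / α) := by
    refine mod_cast Real.contDiff_rpow_const_of_le (n := 1) (p := 2 / α) ?_
    rw [Nat.cast_one, le_div_iff₀ hα]
    linarith
  have hT : 0 < c ^ (-(2 / α)) := rpow_pos_of_pos hc _
  have hG := (contDiffOn_integral_one_sub_mul_rpow hT hα hφ).comp (s := Ico 0 c) hp.contDiffOn
    fun η hη => rpow_lt_one_div hα hc hη.1 hη.2
  exact (contDiffOn_const.mul (hp.contDiffOn.mul hG)).congr fun η hη => EK_eq_of_eq_zero hα hW hη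

end Scaling

section Regularity

variable {α : ℝ} {U : ℝ → ℝ}

lemma exists_contDiffOn_EK_eq_add (hα : 0 < α) (hα1 : α < 1) (hU : Continuous U)
    (hφ : IntervalIntegrable (fun w : ℝ => U (w ^ (-(α / 2)))) volume 0 1)
    {V : ℝ → ℝ} {A C c : ℝ} (hV : Continuous V) (hb : ∀ x, |V x| ≤ A + C * |x|) (hc : 0 < c)
    (hUV : EqOn U V (Icc 0 c)) :
    ∃ R : ℝ → ℝ, ContDiffOn ℝ 1 R (Ico 0 c) ∧ ∀ η ∈ Ico 0 c, EK α U η = EK α V η + R η := by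
  have hT : 0 < c ^ (-(2 / α)) := rpow_pos_of_pos hc _
  have hW : ∀ z ∈ Icc 0 c, U z - V z = 0 := fun z hz => sub_eq_zero.2 (hUV hz)
  have hφW : IntervalIntegrable (fun w : ℝ => U (w ^ (-(α / 2))) - V (w ^ (-(α / 2))))
      volume 0 (c ^ (-(2 / α))) :=
    (intervalIntegrable_comp_rpow_extend hU one_pos hT hφ).sub
      (intervalIntegrable_comp_rpow_of_linear_growth hα1 hV hb hT.le)
  refine ⟨EK α fun z => U z - V z, EK_contDiffOn_of_eq_zero hα hα1 hc hW hφW, fun η hη => ?_⟩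
  unfold EK
  rw [← mul_add, ← intervalIntegral.integral_add
    (intervalIntegrable_kernel_mul_of_linear_growth hα hα1 hV hb η)
    (intervalIntegrable_kernel_of_eq_zero hα hW hφW hη)]
  congr 2
  ext s
  ring

lemma mem_nhdsWithin_Ico_of_lt {x c : ℝ} (hxc : x < c) (S : Set ℝ) (hS : S ⊆ Ici 0) :
    Ico 0 c ∈ 𝓝[S] x := by
  filter_upwards [self_mem_nhdsWithin, mem_nhdsWithin_of_mem_nhds (Iio_mem_nhds hxc)]
    with y hy hyc using ⟨hS hy, hyc⟩

lemma EK_continuousOn (hα : 0 < α) (hα1 : α < 1) (hU : Continuous U)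
    (hφ : IntervalIntegrable (fun w : ℝ => U (w ^ (-(α / 2)))) volume 0 1) :
    ContinuousOn (EK α U) (Ici 0) := by
  intro x hx
  have hx0 : 0 ≤ x := hx
  have hc : 0 < x + 1 := by linarith
  let V : ℝ → ℝ := IccExtend hc.le fun y => U y
  have hV : Continuous V := (hU.comp continuous_subtype_val).Icc_extend'
  obtain ⟨A, hA⟩ := (isCompact_Icc (a := 0) (b := x + 1)).exists_bound_of_continuousOn
    hU.continuousOn
  have hVA : ∀ y, |V y| ≤ A := fun y => hA _ (projIcc 0 (x + 1) hc.le y).2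
  obtain ⟨R, hR, hEK⟩ := exists_contDiffOn_EK_eq_add (A := A) (C := 0) (c := x + 1) hα hα1 hU hφ hV
    (by simpa using hVA) hc fun y hy => (IccExtend_of_mem hc.le (fun y => U y) hy).symm
  have hcont : ContinuousOn (EK α U) (Ico 0 (x + 1)) :=
    ((EK_continuous_of_bounded hα1 hV hVA).continuousOn.add hR.continuousOn).congr hEK
  exact (hcont x ⟨hx, by linarith⟩).mono_of_mem_nhdsWithin
    (mem_nhdsWithin_Ico_of_lt (by linarith) _ subset_rfl)

lemma EK_contDiffOn (hα : 0 < α) (hα1 : α < 1) (hU : Continuous U)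
    (hφ : IntervalIntegrable (fun w : ℝ => U (w ^ (-(α / 2)))) volume 0 1) {b : ℝ} {d : ℝ → ℝ}
    (hd : ContinuousOn d (Ico 0 b)) (hUd : ∀ x ∈ Ioo 0 b, HasDerivAt U (d x) x) :
    ContDiffOn ℝ 1 (EK α U) (Ico 0 b) := by
  intro x hx
  obtain ⟨c, hxc, hcb⟩ := exists_between hx.2
  have hc : 0 < c := hx.1.trans_lt hxc
  have hdc : ContinuousOn d (Icc 0 c) := hd.mono fun y hy => ⟨hy.1, hy.2.trans_lt hcb⟩
  let g : ℝ → ℝ := IccExtend hc.le ((Icc 0 c).domRestrict d)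
  have hg : Continuous g := hdc.domRestrict.Icc_extend'
  obtain ⟨C, hC⟩ := isCompact_Icc.exists_bound_of_continuousOn hdc
  have hgC : ∀ y, |g y| ≤ C := fun y => hC _ (projIcc 0 c hc.le y).2
  let V : ℝ → ℝ := fun x => U 0 + ∫ y in (0:ℝ)..x, g y
  have hVg : ∀ x, HasDerivAt V (g x) x := fun x =>
    (hg.integral_hasStrictDerivAt 0 x).hasDerivAt.const_add _
  have hUV : EqOn U V (Icc 0 c) := by
    intro y hy
    have h := intervalIntegral.integral_eq_sub_of_hasDerivAt_of_le hy.1 hU.continuousOn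
      (f' := g) (fun z hz => ?_) (hg.intervalIntegrable _ _)
    · simp only [V, h]; ring
    · have hz' : z ∈ Icc 0 c := ⟨hz.1.le, hz.2.le.trans hy.2⟩
      have : g z = d z := IccExtend_of_mem hc.le _ hz'
      rw [this]
      exact hUd z ⟨hz.1, hz'.2.trans_lt hcb⟩
  obtain ⟨R, hR, hEK⟩ := exists_contDiffOn_EK_eq_add hα hα1 hU hφ
    (continuous_iff_continuousAt.2 fun x => (hVg x).continuousAt)
    (abs_le_of_hasDerivAt hVg hgC) hc hUV
  have hcd : ContDiffOn ℝ 1 (EK α U) (Ico 0 c) :=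
    ((EK_contDiff_of_bounded_deriv hα hα1 hVg hg hgC).contDiffOn.add hR).congr hEK
  exact (hcd x ⟨hx.1, hxc⟩).mono_of_mem_nhdsWithin
    (mem_nhdsWithin_Ico_of_lt hxc _ fun y hy => hy.1)

/-- On the open half-line the Erdélyi–Kober image of a continuous function agrees with a continuous
function, whose regularity is that of the original function. -/
lemma exists_continuous_EK_eq (hα : 0 < α) (hα1 : α < 1) (hU : Continuous U) :
    ∃ J : ℝ → ℝ, Continuous J ∧ (∀ η, 0 < η → EK α U η = J η) ∧
      ∀ (b : ℝ) (d : ℝ → ℝ), ContinuousOn d (Ico 0 b) → (∀ x ∈ Ioo 0 b, HasDerivAt U (d x) x) →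
        ContDiffOn ℝ 1 J (Ico 0 b) := by
  by_cases hφ : IntervalIntegrable (fun w : ℝ => U (w ^ (-(α / 2)))) volume 0 1
  · refine ⟨fun η => EK α U (max η 0), ?_, fun η hη => by simp only [max_eq_left hη.le], ?_⟩
    · exact (EK_continuousOn hα hα1 hU hφ).comp_continuous (by fun_prop) fun x => mem_Ici.2 (le_max_right x 0)
    · intro b d hd hUd
      exact (EK_contDiffOn hα hα1 hU hφ hd hUd).congr fun x hx => by rw [max_eq_left hx.1]
  · refine ⟨0, continuous_zero, fun η hη => ?_, fun _ _ _ _ => contDiffOn_const⟩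
    unfold EK
    rw [intervalIntegral.integral_undef fun h =>
      hφ (intervalIntegrable_comp_rpow_of_kernel hα hU hη h), mul_zero]
    rfl

end Regularity

/-- a continuous, positive solution of the Volterra equation is twice
continuously differentiable and solves the self-similar fractional porous medium
equation, with U(0) = 1 and U'(0) = -β. -/
theorem volterra_implies_ode (α m β b : ℝ) (hα : 0 < α) (hα1 : α < 1) (hm : 1 < m)
    (hβ : 0 < β) (hb : 0 < b) (U : ℝ → ℝ) (hU : Continuous U)
    (heq : ∀ η, 0 ≤ η →
      U η ^ (m + 1) = 1 + (m + 1) * (-(β * η) +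
        ∫ z in (0:ℝ)..η, ((1 - α / 2) * η - z) * EK α U z))
    (hpos : ∀ η ∈ Set.Ico (0:ℝ) b, 0 < U η) :
    ContDiffOn ℝ 2 U (Set.Ico 0 b) ∧ U 0 = 1 ∧
      derivWithin U (Set.Ici 0) 0 = -β ∧
      ∀ η ∈ Set.Ioo (0:ℝ) b,
        derivWithin (fun t => U t ^ m * derivWithin U (Set.Ici 0) t) (Set.Ici 0) η =
          (1 - α) * EK α U η - α / 2 * η * derivWithin (EK α U) (Set.Ici 0) η := by
  obtain ⟨J, hJ, hEK, hJreg⟩ := exists_continuous_EK_eq hα hα1 hU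
  have hm1 : 0 < m + 1 := by linarith
  have hmem0 : (0:ℝ) ∈ Ico 0 b := ⟨le_rfl, hb⟩
  let E : ℝ → ℝ := fun t => -β + ((1 - α / 2) * (∫ z in (0:ℝ)..t, J z) - α / 2 * (t * J t))
  let V : ℝ → ℝ := fun t => 1 + (m + 1) * (-(β * t) +
    ((1 - α / 2) * t * (∫ z in (0:ℝ)..t, J z) - ∫ z in (0:ℝ)..t, z * J z))
  have hint : ∀ t, HasDerivAt (fun t => ∫ z in (0:ℝ)..t, J z) (J t) t := fun t =>
    (hJ.integral_hasStrictDerivAt 0 t).hasDerivAt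
  have hintz : ∀ t, HasDerivAt (fun t => ∫ z in (0:ℝ)..t, z * J z) (t * J t) t := fun t =>
    ((continuous_id.mul hJ).integral_hasStrictDerivAt 0 t).hasDerivAt
  have hV : ∀ t, HasDerivAt V ((m + 1) * E t) t := by
    intro t
    have h := (((((hasDerivAt_id t).const_mul β).neg).add
      ((((hasDerivAt_id t).const_mul (1 - α / 2)).mul (hint t)).sub (hintz t))).const_mul
        (m + 1)).const_add 1
    refine h.congr_deriv ?_
    simp only [E, id]
    ring
  have hEc : Continuous E := by
    have : Continuous fun t => ∫ z in (0:ℝ)..t, J z :=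
      continuous_iff_continuousAt.2 fun t => (hint t).continuousAt
    fun_prop
  have hUV : ∀ t, 0 ≤ t → U t ^ (m + 1) = V t := by
    intro t ht
    rw [heq t ht]
    have h1 : ∫ z in (0:ℝ)..t, ((1 - α / 2) * t - z) * EK α U z =
        ∫ z in (0:ℝ)..t, ((1 - α / 2) * t * J z - z * J z) := by
      refine intervalIntegral.integral_congr_ae (Eventually.of_forall fun z hz => ?_)
      rw [uIoc_of_le ht] at hz
      rw [hEK z hz.1]
      ring
    rw [h1, intervalIntegral.integral_sub ((by fun_prop : Continuous _).intervalIntegrable _ _)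
      ((by fun_prop : Continuous _).intervalIntegrable _ _),
      intervalIntegral.integral_const_mul]
  have hVpos : ∀ t ∈ Ico 0 b, 0 < V t := fun t ht => by
    rw [← hUV t ht.1]
    exact rpow_pos_of_pos (hpos t ht) _
  have hUroot : ∀ t ∈ Ico 0 b, U t = V t ^ (m + 1)⁻¹ := fun t ht => by
    rw [← hUV t ht.1, rpow_rpow_inv (hpos t ht).le hm1.ne']
  have hUd : ∀ t ∈ Ico 0 b, HasDerivWithinAt U (E t / U t ^ m) (Ici 0) t := by
    intro t ht
    have h := ((hV t).hasDerivWithinAt (s := Ici 0)).rpow_const (p := (m + 1)⁻¹)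
      (Or.inl (hVpos t ht).ne')
    have hev : U =ᶠ[𝓝[Ici 0] t] fun t => V t ^ (m + 1)⁻¹ := by
      filter_upwards [self_mem_nhdsWithin, mem_nhdsWithin_of_mem_nhds (Iio_mem_nhds ht.2)]
        with y hy hyb using hUroot y ⟨hy, hyb⟩
    refine (h.congr_of_eventuallyEq hev (hUroot t ht)).congr_deriv ?_
    rw [← hUV t ht.1, ← rpow_mul (hpos t ht).le,
      show (m + 1) * ((m + 1)⁻¹ - 1) = -m by field_simp; ring, rpow_neg (hpos t ht).le]
    field_simp
  have hUdw : ∀ t ∈ Ico 0 b, derivWithin U (Ici 0) t = E t / U t ^ m := fun t ht =>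
    (hUd t ht).derivWithin (uniqueDiffOn_Ici 0 t ht.1)
  have hJC : ContDiffOn ℝ 1 J (Ico 0 b) := by
    refine hJreg b (fun t => E t / U t ^ m) ?_ fun t ht =>
      (hUd t (Ioo_subset_Ico_self ht)).hasDerivAt (Ici_mem_nhds ht.1)
    exact hEc.continuousOn.div
      (hU.continuousOn.rpow_const fun t ht => Or.inl (hpos t ht).ne')
      fun t ht => (rpow_pos_of_pos (hpos t ht) _).ne'
  have hU0 : U 0 = 1 := by
    rw [hUroot 0 hmem0]
    simp [V]
  refine ⟨?_, hU0, ?_, ?_⟩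
  · have hIJ : ContDiff ℝ 1 fun t => ∫ z in (0:ℝ)..t, J z := by
      rw [contDiff_one_iff_deriv]
      refine ⟨fun t => (hint t).differentiableAt, ?_⟩
      rwa [funext fun t => (hint t).deriv]
    have hEC : ContDiffOn ℝ 1 (fun t => (m + 1) * E t) (Ico 0 b) :=
      contDiffOn_const.mul (contDiffOn_const.add
        ((contDiffOn_const.mul hIJ.contDiffOn).sub
          (contDiffOn_const.mul (contDiffOn_id.mul hJC))))
    have hVC : ContDiffOn ℝ 2 V (Ico 0 b) := by
      rw [show (2 : WithTop ℕ∞) = 1 + 1 by norm_num,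
        contDiffOn_succ_iff_derivWithin (uniqueDiffOn_Ico 0 b)]
      refine ⟨fun t _ => (hV t).differentiableAt.differentiableWithinAt, by simp,
        hEC.congr fun t ht => (hV t).hasDerivWithinAt.derivWithin (uniqueDiffOn_Ico 0 b t ht)⟩
    exact (hVC.rpow_const_of_ne fun t ht => (hVpos t ht).ne').congr hUroot
  · rw [hUdw 0 hmem0, hU0]
    simp [E]
  · intro η hη
    have hnhds : Ioo 0 b ∈ 𝓝 η := Ioo_mem_nhds hη.1 hη.2
    have hJd : HasDerivAt J (deriv J η) η :=
      (((hJC.differentiableOn one_ne_zero) η (Ioo_subset_Ico_self hη)).differentiableAt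
        (Ico_mem_nhds hη.1 hη.2)).hasDerivAt
    have hEKev : EK α U =ᶠ[𝓝 η] J := by
      filter_upwards [hnhds] with y hy using hEK y hy.1
    have hflux : (fun t => U t ^ m * derivWithin U (Ici 0) t) =ᶠ[𝓝 η] E := by
      filter_upwards [hnhds] with y hy
      have := rpow_pos_of_pos (hpos y (Ioo_subset_Ico_self hy)) m
      rw [hUdw y (Ioo_subset_Ico_self hy), mul_div_cancel₀ _ this.ne']
    have hEd : HasDerivAt E ((1 - α / 2) * J η - α / 2 * (1 * J η + η * deriv J η)) η :=
      (((hint η).const_mul _).sub (((hasDerivAt_id η).mul hJd).const_mul _)).const_add _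
    have hη0 : η ∈ Ici (0:ℝ) := hη.1.le
    rw [((hEd.congr_of_eventuallyEq hflux).hasDerivWithinAt).derivWithin
        (uniqueDiffOn_Ici 0 η hη0),
      ((hJd.congr_of_eventuallyEq hEKev).hasDerivWithinAt).derivWithin (uniqueDiffOn_Ici 0 η hη0),
      hEK η hη.1]
    ring
end

section
/- (Main existence theorem) For 0 < α < 1, m > 1 and β ≥ β₀ := (2-α)/√(2Γ(2-α)(m+1)), there exists a continuous function Y : [0,∞) → [0,1] with Y(0) = 1, compactly supported with supp Y = [0, η*(β)] for some η*(β) ∈ [η₂(β), η₁(β)], such that for η ≤ η*(β): Y(η) = 1 + (m+1)[ −βη + ∫₀^η ((1−α/2)η − z) I^{0,1-α}_{-2/α} Y^{1/(1+m)}(z) dz ], and Y(η) = 0 for η > η*(β). -/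
open Real

/-- The root η₁(β). -/
noncomputable def eta1 (α m β : ℝ) : ℝ :=
  4 * β * Real.Gamma (2 - α) / (2 - α) ^ 2 -
    2 * Real.sqrt 2 / ((2 - α) ^ 2 * Real.sqrt (m + 1)) *
      Real.sqrt (2 * β ^ 2 * (m + 1) * Real.Gamma (2 - α) ^ 2 - (2 - α) * Real.Gamma (3 - α))

/-- The root η₂(β). -/
noncomputable def eta2 (α m β : ℝ) : ℝ :=
  2 * Real.sqrt 2 *
      Real.sqrt (Real.Gamma (2 - α) * (α ^ 2 + 2 * β ^ 2 * (m + 1) * Real.Gamma (2 - α))) /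
    (α ^ 2 * Real.sqrt (m + 1)) - 4 * β * Real.Gamma (2 - α) / α ^ 2

namespace ErdelyiKober

open MeasureTheory Set Filter Topology

/-- Antitone functions on the line with values in `[0, C]`. -/
structure IsProfile (C : ℝ) (W : ℝ → ℝ) : Prop where
  antitone : Antitone W
  nonneg : ∀ t, 0 ≤ W t
  le : ∀ t, W t ≤ C

lemma IsProfile.rpow {C p : ℝ} {W : ℝ → ℝ} (hW : IsProfile C W) (hp : 0 ≤ p) :
    IsProfile (C ^ p) (fun t => W t ^ p) where
  antitone _ _ h := Real.rpow_le_rpow (hW.nonneg _) (hW.antitone h) hp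
  nonneg t := Real.rpow_nonneg (hW.nonneg t) p
  le t := Real.rpow_le_rpow (hW.nonneg t) (hW.le t) hp

lemma intervalIntegrable_weight {α : ℝ} (hα1 : α < 1) :
    IntervalIntegrable (fun s : ℝ => (1 - s) ^ (-α)) volume 0 1 := by
  have h := (intervalIntegral.intervalIntegrable_rpow' (a := 0) (b := 1)
    (show -1 < -α by linarith)).comp_sub_left 1
  simpa using h.symm

lemma integral_weight {α : ℝ} (hα1 : α < 1) :
    ∫ s in (0 : ℝ)..1, (1 - s) ^ (-α) = 1 / (1 - α) := by
  rw [intervalIntegral.integral_comp_sub_left (fun s : ℝ => s ^ (-α)),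
    integral_rpow (Or.inl (by linarith))]
  have h : -α + 1 ≠ 0 := by linarith
  simp [Real.zero_rpow h]
  ring_nf

lemma intervalIntegrable_integrand {α C : ℝ} {W : ℝ → ℝ} (hα1 : α < 1) (hW : IsProfile C W)
    (η : ℝ) :
    IntervalIntegrable (fun s : ℝ => (1 - s) ^ (-α) * W (s ^ (-(α / 2)) * η)) volume 0 1 := by
  have hm := hW.antitone.measurable
  refine ((intervalIntegrable_weight hα1).mul_const C).mono_fun' ?_ ?_
  · exact Measurable.aestronglyMeasurable (by fun_prop)
  · refine (ae_restrict_mem measurableSet_uIoc).mono fun s hs => ?_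
    rw [uIoc_of_le zero_le_one] at hs
    have h0 : 0 ≤ (1 - s) ^ (-α) := Real.rpow_nonneg (by linarith [hs.2]) _
    dsimp only
    rw [Real.norm_of_nonneg (mul_nonneg h0 (hW.nonneg _))]
    exact mul_le_mul_of_nonneg_left (hW.le _) h0

lemma EK_le_EK {α C D a b : ℝ} {W U : ℝ → ℝ} (hα1 : α < 1) (hW : IsProfile C W)
    (hU : IsProfile D U) (h : ∀ s ∈ Icc (0 : ℝ) 1,
      W (s ^ (-(α / 2)) * a) ≤ U (s ^ (-(α / 2)) * b)) : EK α W a ≤ EK α U b := by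
  refine mul_le_mul_of_nonneg_left ?_
    (one_div_nonneg.2 (Real.Gamma_pos_of_pos (by linarith)).le)
  refine intervalIntegral.integral_mono_on zero_le_one (intervalIntegrable_integrand hα1 hW a)
    (intervalIntegrable_integrand hα1 hU b) fun s hs => ?_
  exact mul_le_mul_of_nonneg_left (h s hs) (Real.rpow_nonneg (by linarith [hs.2]) _)

lemma EK_mono {α C D : ℝ} {W U : ℝ → ℝ} (hα1 : α < 1) (hW : IsProfile C W)
    (hU : IsProfile D U) (h : ∀ t, W t ≤ U t) (η : ℝ) : EK α W η ≤ EK α U η :=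
  EK_le_EK hα1 hW hU fun _ _ => h _

lemma EK_const_mul (α c : ℝ) (W : ℝ → ℝ) (η : ℝ) :
    EK α (fun t => c * W t) η = c * EK α W η := by
  simp only [EK, mul_left_comm _ c, intervalIntegral.integral_const_mul]

lemma EK_comp_div (α μ : ℝ) (W : ℝ → ℝ) (η : ℝ) :
    EK α (fun t => W (t / μ)) η = EK α W (η / μ) := by
  simp only [EK, mul_div_assoc]

lemma EK_const {α : ℝ} (hα1 : α < 1) (C η : ℝ) :
    EK α (fun _ => C) η = C / Real.Gamma (2 - α) := by
  have h : Real.Gamma (2 - α) = (1 - α) * Real.Gamma (1 - α) := by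
    rw [← Real.Gamma_add_one (by linarith)]; congr 1; ring
  have h1 : 1 - α ≠ 0 := by linarith
  have h2 : Real.Gamma (1 - α) ≠ 0 := (Real.Gamma_pos_of_pos (by linarith)).ne'
  rw [EK, intervalIntegral.integral_mul_const, integral_weight hα1, h]
  field_simp

lemma IsProfile.nonneg_bound {C : ℝ} {W : ℝ → ℝ} (hW : IsProfile C W) : 0 ≤ C :=
  (hW.nonneg 0).trans (hW.le 0)

lemma isProfile_const {C : ℝ} (hC : 0 ≤ C) : IsProfile C (fun _ => C) :=
  ⟨antitone_const, fun _ => hC, fun _ => le_rfl⟩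

lemma isProfile_EK {α C : ℝ} {W : ℝ → ℝ} (hα1 : α < 1) (hW : IsProfile C W) :
    IsProfile (C / Real.Gamma (2 - α)) (EK α W) where
  antitone a b hab := EK_le_EK hα1 hW hW fun s hs =>
    hW.antitone (mul_le_mul_of_nonneg_left hab (Real.rpow_nonneg hs.1 _))
  nonneg t := by
    refine mul_nonneg (one_div_nonneg.2 (Real.Gamma_pos_of_pos (by linarith)).le)
      (intervalIntegral.integral_nonneg zero_le_one fun s hs => ?_)
    exact mul_nonneg (Real.rpow_nonneg (by linarith [hs.2]) _) (hW.nonneg _)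
  le t := by
    rw [← EK_const hα1 C t]
    exact EK_mono hα1 hW (isProfile_const hW.nonneg_bound) hW.le t

lemma tendsto_EK {ι : Type*} {l : Filter ι} [l.IsCountablyGenerated] {α C : ℝ} {W : ι → ℝ → ℝ}
    {U : ℝ → ℝ} (hα1 : α < 1) (hW : ∀ᶠ i in l, IsProfile C (W i))
    (h : ∀ t, Tendsto (fun i => W i t) l (𝓝 (U t))) (η : ℝ) :
    Tendsto (fun i => EK α (W i) η) l (𝓝 (EK α U η)) := by
  refine Tendsto.const_mul _ ?_
  refine intervalIntegral.tendsto_integral_filter_of_dominated_convergence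
    (fun s => (1 - s) ^ (-α) * C) ?_ ?_ ((intervalIntegrable_weight hα1).mul_const C) ?_
  · filter_upwards [hW] with i hi
    have hm := hi.antitone.measurable
    exact Measurable.aestronglyMeasurable (by fun_prop)
  · filter_upwards [hW] with i hi
    refine ae_of_all _ fun s hs => ?_
    rw [uIoc_of_le zero_le_one] at hs
    have h0 : 0 ≤ (1 - s) ^ (-α) := Real.rpow_nonneg (by linarith [hs.2]) _
    rw [Real.norm_of_nonneg (mul_nonneg h0 (hi.nonneg _))]
    exact mul_le_mul_of_nonneg_left (hi.le _) h0
  · exact ae_of_all _ fun s _ => (h _).const_mul _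

lemma IsProfile.intervalIntegrable {C : ℝ} {V : ℝ → ℝ} (hV : IsProfile C V) (a b : ℝ) :
    IntervalIntegrable V volume a b :=
  hV.antitone.intervalIntegrable

lemma IsProfile.intervalIntegrable_mul {C : ℝ} {V : ℝ → ℝ} (hV : IsProfile C V) {f : ℝ → ℝ}
    (hf : Continuous f) (a b : ℝ) : IntervalIntegrable (fun z => f z * V z) volume a b :=
  (hV.intervalIntegrable a b).continuousOn_mul hf.continuousOn

/-- Projection of the line onto `[0, 1]`. -/
noncomputable def clamp (η : ℝ) : ℝ := max 0 (min η 1)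

lemma clamp_mono : Monotone clamp := fun _ _ h => max_le_max_left _ (min_le_min_right _ h)

lemma continuous_clamp : Continuous clamp := by unfold clamp; fun_prop

lemma clamp_nonneg (η : ℝ) : 0 ≤ clamp η := le_max_left _ _

lemma clamp_le_one (η : ℝ) : clamp η ≤ 1 := max_le zero_le_one (min_le_right _ _)

lemma clamp_of_mem {η : ℝ} (h : η ∈ Icc (0 : ℝ) 1) : clamp η = η := by
  simp [clamp, h.1, h.2]

lemma clamp_of_one_le {η : ℝ} (h : 1 ≤ η) : clamp η = 1 := by simp [clamp, h]

/-- The order-preserving operator obtained by integrating the equation backwards from a front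
at `1` with slope `-κ`. -/
noncomputable def frontOp (α p κ : ℝ) (y : ℝ → ℝ) (η : ℝ) : ℝ :=
  κ * (1 - clamp η) +
    ∫ z in (clamp η)..1, (z - (1 - α / 2) * clamp η) * EK α (fun t => y t ^ p) z

section Op

variable {α p κ K : ℝ} {y : ℝ → ℝ}

lemma kernel_nonneg {x z : ℝ} (hα : 0 < α) (hx : 0 ≤ x) (hz : x ≤ z) :
    0 ≤ z - (1 - α / 2) * x := by
  nlinarith [mul_nonneg hα.le hx]

lemma frontOp_nonneg (hα : 0 < α) (hα1 : α < 1) (hp : 0 ≤ p) (hκ : 0 ≤ κ) (hy : IsProfile K y)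
    (η : ℝ) : 0 ≤ frontOp α p κ y η := by
  refine add_nonneg (mul_nonneg hκ (by linarith [clamp_le_one η]))
    (intervalIntegral.integral_nonneg (clamp_le_one η) fun z hz => ?_)
  exact mul_nonneg (kernel_nonneg hα (clamp_nonneg η) hz.1) ((isProfile_EK hα1 (hy.rpow hp)).nonneg z)

lemma frontOp_mono (hα : 0 < α) (hα1 : α < 1) (hp : 0 ≤ p) {κ' L : ℝ} {u : ℝ → ℝ} (hκ : κ ≤ κ')
    (hy : IsProfile K y) (hu : IsProfile L u) (h : ∀ t, y t ≤ u t) (η : ℝ) :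
    frontOp α p κ y η ≤ frontOp α p κ' u η := by
  refine add_le_add (mul_le_mul_of_nonneg_right hκ (by linarith [clamp_le_one η])) ?_
  refine intervalIntegral.integral_mono_on (clamp_le_one η)
    ((isProfile_EK hα1 (hy.rpow hp)).intervalIntegrable_mul (by fun_prop) _ _)
    ((isProfile_EK hα1 (hu.rpow hp)).intervalIntegrable_mul (by fun_prop) _ _) fun z hz => ?_
  exact mul_le_mul_of_nonneg_left (EK_mono hα1 (hy.rpow hp) (hu.rpow hp)
    (fun t => Real.rpow_le_rpow (hy.nonneg t) (h t) hp) z)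
    (kernel_nonneg hα (clamp_nonneg η) hz.1)

lemma frontOp_antitone (hα : 0 < α) (hα1 : α < 1) (hp : 0 ≤ p) (hκ : 0 ≤ κ)
    (hy : IsProfile K y) : Antitone (frontOp α p κ y) := by
  intro η ξ h
  have hV := isProfile_EK hα1 (hy.rpow hp)
  have hc := clamp_mono h
  refine add_le_add (mul_le_mul_of_nonneg_left (by linarith) hκ) ?_
  rw [← intervalIntegral.integral_add_adjacent_intervals
    (hV.intervalIntegrable_mul (by fun_prop) (clamp η) (clamp ξ))
    (hV.intervalIntegrable_mul (by fun_prop) (clamp ξ) 1)]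
  refine (intervalIntegral.integral_mono_on (clamp_le_one ξ)
    (hV.intervalIntegrable_mul (by fun_prop) _ _)
    (hV.intervalIntegrable_mul (by fun_prop) _ _) fun z _ => ?_).trans
    (le_add_of_nonneg_left (intervalIntegral.integral_nonneg hc fun z hz => ?_))
  · exact mul_le_mul_of_nonneg_right (by nlinarith) (hV.nonneg z)
  · exact mul_nonneg (kernel_nonneg hα (clamp_nonneg η) hz.1) (hV.nonneg z)

lemma frontOp_apply_zero : frontOp α p κ y 0 =
    κ + ∫ z in (0 : ℝ)..1, z * EK α (fun t => y t ^ p) z := by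
  simp [frontOp, clamp]

lemma frontOp_apply_of_one_le {η : ℝ} (h : 1 ≤ η) : frontOp α p κ y η = 0 := by
  simp [frontOp, clamp_of_one_le h]

lemma frontOp_apply_of_nonpos {η : ℝ} (h : η ≤ 0) : frontOp α p κ y η = frontOp α p κ y 0 := by
  have : clamp η = 0 := by simp [clamp, h]
  have h0 : clamp 0 = 0 := by simp [clamp]
  simp [frontOp, this, h0]

lemma isProfile_frontOp (hα : 0 < α) (hα1 : α < 1) (hp : 0 ≤ p) (hκ : 0 ≤ κ)
    (hy : IsProfile K y) :
    IsProfile (κ + K ^ p / Real.Gamma (2 - α)) (frontOp α p κ y) where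
  antitone := frontOp_antitone hα hα1 hp hκ hy
  nonneg := frontOp_nonneg hα hα1 hp hκ hy
  le t := by
    have hV := isProfile_EK hα1 (hy.rpow hp)
    have h0 : frontOp α p κ y t ≤ frontOp α p κ y 0 := by
      rcases le_total t 0 with h | h
      · exact (frontOp_apply_of_nonpos h).le
      · exact frontOp_antitone hα hα1 hp hκ hy h
    refine h0.trans ?_
    rw [frontOp_apply_zero]
    gcongr
    calc _ ≤ ∫ z in (0 : ℝ)..1, K ^ p / Real.Gamma (2 - α) := by
          refine intervalIntegral.integral_mono_on zero_le_one
            (hV.intervalIntegrable_mul continuous_id _ _) (by simp) fun z hz => ?_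
          nlinarith [hV.nonneg z, hV.le z, hz.1, hz.2]
      _ = _ := by simp

lemma continuous_frontOp (hα1 : α < 1) (hp : 0 ≤ p) (hy : IsProfile K y) :
    Continuous (frontOp α p κ y) := by
  have hV := isProfile_EK hα1 (hy.rpow hp)
  have hF : ∀ {f : ℝ → ℝ}, Continuous f →
      Continuous fun x => ∫ z in x..1, f z * EK α (fun t => y t ^ p) z := fun hf => by
    have := (intervalIntegral.continuous_primitive
      (fun a b => hV.intervalIntegrable_mul hf a b) 1).neg
    exact this.congr fun x => (intervalIntegral.integral_symm 1 x).symm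
  have key : frontOp α p κ y = fun η => κ * (1 - clamp η) +
      ((∫ z in (clamp η)..1, z * EK α (fun t => y t ^ p) z) -
        (1 - α / 2) * clamp η * ∫ z in (clamp η)..1, 1 * EK α (fun t => y t ^ p) z) := by
    funext η
    rw [← intervalIntegral.integral_const_mul, ← intervalIntegral.integral_sub
      (hV.intervalIntegrable_mul (by fun_prop) _ _)
      ((hV.intervalIntegrable_mul (by fun_prop) _ _).const_mul _)]
    simp only [frontOp]
    congr 2
    funext z
    ring
  have h1 := (hF (f := fun z => z) (by fun_prop)).comp continuous_clamp
  have h2 := (hF (f := fun _ => 1) (by fun_prop)).comp continuous_clamp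
  have hc := continuous_clamp
  rw [key]
  simp only [Function.comp_def] at h1 h2
  fun_prop

lemma mul_frontOp_le (hα : 0 < α) (hα1 : α < 1) (hp : 0 ≤ p) (hp1 : p ≤ 1) {t : ℝ}
    (ht : 0 < t) (ht1 : t ≤ 1) (hy : IsProfile K y) (η : ℝ) :
    t * frontOp α p κ y η ≤ frontOp α p (t * κ) (fun x => t * y x) η := by
  have hV := isProfile_EK hα1 (hy.rpow hp)
  have h : EK α (fun x => (t * y x) ^ p) = fun z => t ^ p * EK α (fun x => y x ^ p) z := by
    funext z
    rw [← EK_const_mul]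
    simp only [Real.mul_rpow ht.le (hy.nonneg _)]
  simp only [frontOp, h, mul_left_comm _ (t ^ p), intervalIntegral.integral_const_mul]
  rw [mul_add, mul_assoc]
  gcongr
  · refine intervalIntegral.integral_nonneg (clamp_le_one η) fun z hz => ?_
    exact mul_nonneg (kernel_nonneg hα (clamp_nonneg η) hz.1) (hV.nonneg z)
  · simpa using Real.rpow_le_rpow_of_exponent_ge ht ht1 hp1

lemma tendsto_integral_mul_EK {ι : Type*} {l : Filter ι} [l.IsCountablyGenerated]
    {Y : ι → ℝ → ℝ} (hα1 : α < 1) (hp : 0 ≤ p) (hY : ∀ᶠ i in l, IsProfile K (Y i))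
    (h : ∀ t, Tendsto (fun i => Y i t) l (𝓝 (y t))) {f : ℝ → ℝ} (hf : Continuous f) (a b : ℝ) :
    Tendsto (fun i => ∫ z in a..b, f z * EK α (fun t => Y i t ^ p) z) l
      (𝓝 (∫ z in a..b, f z * EK α (fun t => y t ^ p) z)) := by
  refine intervalIntegral.tendsto_integral_filter_of_dominated_convergence
    (fun z => |f z| * (K ^ p / Real.Gamma (2 - α))) ?_ ?_
    (Continuous.intervalIntegrable (by fun_prop) _ _) ?_
  · filter_upwards [hY] with i hi
    exact (hf.measurable.mul (isProfile_EK hα1 (hi.rpow hp)).antitone.measurable).aestronglyMeasurable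
  · filter_upwards [hY] with i hi
    refine ae_of_all _ fun z _ => ?_
    have hV := isProfile_EK hα1 (hi.rpow hp)
    rw [norm_mul, Real.norm_eq_abs, Real.norm_of_nonneg (hV.nonneg z)]
    exact mul_le_mul_of_nonneg_left (hV.le z) (abs_nonneg _)
  · refine ae_of_all _ fun z _ => Tendsto.const_mul _ ?_
    exact tendsto_EK hα1 (hY.mono fun i hi => hi.rpow hp) (fun t => (h t).rpow_const (Or.inr hp)) z

end Op

lemma le_EK {α C δ w z : ℝ} {W : ℝ → ℝ} (hα : 0 < α) (hα1 : α < 1) (hW : IsProfile C W)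
    (hδ : 0 ≤ δ) (hδ1 : δ ≤ 1) (hw : 0 ≤ w)
    (h : ∀ s ∈ Icc (1 - δ) 1, w ≤ W (s ^ (-(α / 2)) * z)) :
    1 / Real.Gamma (1 - α) * (δ * w) ≤ EK α W z := by
  have hG : 0 < Real.Gamma (1 - α) := Real.Gamma_pos_of_pos (by linarith)
  have hi := intervalIntegrable_integrand hα1 hW z
  have hsub : ∀ {a b : ℝ}, a ∈ Icc (0 : ℝ) 1 → b ∈ Icc (0 : ℝ) 1 → IntervalIntegrable
      (fun s : ℝ => (1 - s) ^ (-α) * W (s ^ (-(α / 2)) * z)) volume a b := fun ha hb =>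
    hi.mono_set (by rw [uIcc_of_le zero_le_one]; exact uIcc_subset_Icc ha hb)
  have hm : 1 - δ ∈ Icc (0 : ℝ) 1 := ⟨by linarith, by linarith⟩
  refine mul_le_mul_of_nonneg_left ?_ (one_div_nonneg.2 hG.le)
  rw [← intervalIntegral.integral_add_adjacent_intervals (hsub (by simp) hm)
    (hsub hm (by simp))]
  refine le_add_of_nonneg_of_le (intervalIntegral.integral_nonneg hm.1 fun s hs => ?_) ?_
  · exact mul_nonneg (Real.rpow_nonneg (by linarith [hs.2]) _) (hW.nonneg _)
  · calc δ * w = ∫ _ in (1 - δ)..1, w := by simp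
      _ ≤ _ := by
        refine intervalIntegral.integral_mono_on_of_le_Ioo hm.2 (by simp) (hsub hm (by simp))
          fun s hs => ?_
        have h1 : 1 ≤ (1 - s) ^ (-α) := Real.one_le_rpow_of_pos_of_le_one_of_nonpos
          (by linarith [hs.2]) (by linarith [hs.1, hm.1]) (by linarith)
        nlinarith [h s ⟨hs.1.le, hs.2.le⟩]

lemma isProfile_bump {ε K : ℝ} (hε : 0 ≤ ε) (hK : ε ≤ K) :
    IsProfile K (fun t => ε * (1 - clamp t) ^ 4) where
  antitone a b h := by
    have := clamp_mono h
    have := clamp_le_one b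
    dsimp only
    gcongr
  nonneg t := by positivity
  le t := by
    have h0 := clamp_nonneg t
    have h1 := clamp_le_one t
    have : (1 - clamp t) ^ 4 ≤ 1 := pow_le_one₀ (by linarith) (by linarith)
    nlinarith

lemma le_EK_bump {α p ε x d : ℝ} (hα : 0 < α) (hα1 : α < 1) (hp : 0 ≤ p) (hp2 : p ≤ 1 / 2)
    (hε : 0 ≤ ε) (hd : 0 < d) (hd1 : d ≤ 1) (hx : x = 1 - d / 3) :
    1 / Real.Gamma (1 - α) * (d / 6 * (ε ^ p * (d / 6) ^ 2)) ≤
      EK α (fun t => (ε * (1 - clamp t) ^ 4) ^ p) x := by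
  refine le_EK hα hα1 ((isProfile_bump hε le_rfl).rpow hp) (by linarith) (by linarith)
    (by positivity) fun s hs => ?_
  have hs0 : 0 < s := by linarith [hs.1]
  have h1 : s ^ (-(α / 2)) ≤ s⁻¹ := by
    rw [← Real.rpow_neg_one]
    exact Real.rpow_le_rpow_of_exponent_ge hs0 hs.2 (by linarith)
  have h2 : s ^ (-(α / 2)) * x ≤ 1 - d / 6 := by
    calc s ^ (-(α / 2)) * x ≤ s⁻¹ * x := mul_le_mul_of_nonneg_right h1 (by linarith)
      _ ≤ 1 - d / 6 := by
        rw [inv_mul_le_iff₀ hs0]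
        nlinarith [hs.1]
  have h3 : d / 6 ≤ 1 - clamp (s ^ (-(α / 2)) * x) := by
    have := clamp_mono h2
    rw [clamp_of_mem (η := 1 - d / 6) ⟨by linarith, by linarith⟩] at this
    linarith
  have h4 : (d / 6) ^ 2 ≤ ((d / 6) ^ 4) ^ p := by
    have h5 : (d / 6) ^ 4 ≤ 1 := pow_le_one₀ (by linarith) (by linarith)
    calc (d / 6) ^ 2 = ((d / 6) ^ 4) ^ (1 / 2 : ℝ) := by
          rw [← Real.sqrt_eq_rpow, show (d / 6) ^ 4 = ((d / 6) ^ 2) ^ 2 by ring,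
            Real.sqrt_sq (by positivity)]
      _ ≤ _ := Real.rpow_le_rpow_of_exponent_ge (by positivity) h5 hp2
  calc ε ^ p * (d / 6) ^ 2 ≤ ε ^ p * ((d / 6) ^ 4) ^ p := by gcongr
    _ = (ε * (d / 6) ^ 4) ^ p := (Real.mul_rpow hε (by positivity)).symm
    _ ≤ _ := by gcongr

lemma le_frontOp_bump {α p κ ε : ℝ} (hα : 0 < α) (hα1 : α < 1) (hp : 0 ≤ p) (hp2 : p ≤ 1 / 2)
    (hε : 0 ≤ ε) (hκ : 0 ≤ κ) (η : ℝ) :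
    α / (3888 * Real.Gamma (1 - α)) * ε ^ p * (1 - clamp η) ^ 4 ≤
      frontOp α p κ (fun t => ε * (1 - clamp t) ^ 4) η := by
  have hφ := isProfile_bump hε le_rfl
  have hV := isProfile_EK hα1 (hφ.rpow hp)
  have hθ := clamp_nonneg η
  have hθ1 := clamp_le_one η
  have hG : 0 < Real.Gamma (1 - α) := Real.Gamma_pos_of_pos (by linarith)
  rcases hθ1.eq_or_lt with h | h
  · rw [h]
    simpa using frontOp_nonneg hα hα1 hp hκ hφ η
  set d := 1 - clamp η with hd
  set v := 1 / Real.Gamma (1 - α) * (d / 6 * (ε ^ p * (d / 6) ^ 2)) with hv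
  have hd0 : 0 < d := by linarith
  have hv0 : 0 ≤ v := by positivity
  refine le_add_of_nonneg_of_le (by positivity) ?_
  rw [← intervalIntegral.integral_add_adjacent_intervals
    (hV.intervalIntegrable_mul (by fun_prop) (clamp η) (1 - 2 * d / 3))
    (hV.intervalIntegrable_mul (by fun_prop) (1 - 2 * d / 3) 1),
    ← intervalIntegral.integral_add_adjacent_intervals
    (hV.intervalIntegrable_mul (by fun_prop) (1 - 2 * d / 3) (1 - d / 3))
    (hV.intervalIntegrable_mul (by fun_prop) (1 - d / 3) 1)]
  have hpos : ∀ {a b : ℝ}, a ≤ b → clamp η ≤ a → 0 ≤ ∫ z in a..b,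
      (z - (1 - α / 2) * clamp η) * EK α (fun t => (ε * (1 - clamp t) ^ 4) ^ p) z :=
    fun hab ha => intervalIntegral.integral_nonneg hab fun z hz =>
      mul_nonneg (kernel_nonneg hα hθ (ha.trans hz.1)) (hV.nonneg z)
  refine le_add_of_nonneg_of_le (hpos (by linarith) le_rfl)
    (le_add_of_le_of_nonneg ?_ (hpos (by linarith) (by linarith)))
  calc α / (3888 * Real.Gamma (1 - α)) * ε ^ p * d ^ 4
      = ∫ _ in (1 - 2 * d / 3)..(1 - d / 3), α / 6 * v := by
        rw [intervalIntegral.integral_const, smul_eq_mul, hv]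
        field_simp
        ring
    _ ≤ _ := by
        refine intervalIntegral.integral_mono_on (by linarith) (by simp)
          (hV.intervalIntegrable_mul (by fun_prop) _ _) fun z hz => ?_
        refine mul_le_mul ?_ ?_ hv0 (kernel_nonneg hα hθ (by linarith [hz.1]))
        · nlinarith [hz.1]
        · exact (le_EK_bump hα hα1 hp hp2 hε hd0 (by linarith) rfl).trans (hV.antitone hz.2)

lemma exists_bump_le_frontOp {α p K : ℝ} (hα : 0 < α) (hα1 : α < 1) (hp : 0 ≤ p)
    (hp2 : p ≤ 1 / 2) (hK : 0 < K) :
    ∃ ε, 0 < ε ∧ ε ≤ K ∧ ∀ κ, 0 ≤ κ → ∀ t,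
      ε * (1 - clamp t) ^ 4 ≤ frontOp α p κ (fun t => ε * (1 - clamp t) ^ 4) t := by
  have hG : 0 < Real.Gamma (1 - α) := Real.Gamma_pos_of_pos (by linarith)
  set C := α / (3888 * Real.Gamma (1 - α)) with hC
  have hC0 : 0 < C := by positivity
  have hε0 : 0 < min (min 1 (C ^ 2)) K := by positivity
  refine ⟨min (min 1 (C ^ 2)) K, hε0, min_le_right _ _, fun κ hκ t => ?_⟩
  set ε := min (min 1 (C ^ 2)) K
  refine le_trans ?_ (le_frontOp_bump hα hα1 hp hp2 hε0.le hκ t)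
  have h1 : √ε ≤ ε ^ p := by
    rw [Real.sqrt_eq_rpow]
    exact Real.rpow_le_rpow_of_exponent_ge hε0 ((min_le_left _ _).trans (min_le_left _ _)) hp2
  have h2 : √ε ≤ C := by
    rw [Real.sqrt_le_left hC0.le]
    exact (min_le_left _ _).trans (min_le_right _ _)
  refine mul_le_mul_of_nonneg_right ?_ (by positivity)
  calc ε = √ε * √ε := (Real.mul_self_sqrt hε0.le).symm
    _ ≤ C * ε ^ p := mul_le_mul h2 h1 (Real.sqrt_nonneg _) hC0.le

/-- Profiles `u ≤ K` lying below their image under the front operator. -/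
def subsolutions (α p κ K : ℝ) : Set (ℝ → ℝ) :=
  {u | IsProfile K u ∧ ∀ t, u t ≤ frontOp α p κ u t}

/-- The greatest fixed point of the front operator among profiles bounded by `K`. -/
noncomputable def frontSol (α p κ K η : ℝ) : ℝ :=
  sSup ((fun u : ℝ → ℝ => u η) '' subsolutions α p κ K)

section Sol

variable {α p κ K : ℝ}

lemma le_frontSol {u : ℝ → ℝ} (hu : u ∈ subsolutions α p κ K) (t : ℝ) :
    u t ≤ frontSol α p κ K t :=
  le_csSup ⟨K, by rintro _ ⟨v, hv, rfl⟩; exact hv.1.le t⟩ ⟨u, hu, rfl⟩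

lemma zero_mem_subsolutions (hα : 0 < α) (hα1 : α < 1) (hp : 0 ≤ p) (hκ : 0 ≤ κ) (hK : 0 ≤ K) :
    (fun _ => 0) ∈ subsolutions α p κ K := by
  have h : IsProfile K (fun _ => 0) := ⟨antitone_const, fun _ => le_rfl, fun _ => hK⟩
  exact ⟨h, frontOp_nonneg hα hα1 hp hκ h⟩

lemma frontSol_le (hα : 0 < α) (hα1 : α < 1) (hp : 0 ≤ p) (hκ : 0 ≤ κ) (hK : 0 ≤ K) {t b : ℝ}
    (h : ∀ u ∈ subsolutions α p κ K, u t ≤ b) : frontSol α p κ K t ≤ b :=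
  csSup_le (Set.Nonempty.image _ ⟨_, zero_mem_subsolutions hα hα1 hp hκ hK⟩)
    (by rintro _ ⟨u, hu, rfl⟩; exact h u hu)

lemma isProfile_frontSol (hα : 0 < α) (hα1 : α < 1) (hp : 0 ≤ p) (hκ : 0 ≤ κ) (hK : 0 ≤ K) :
    IsProfile K (frontSol α p κ K) where
  antitone _ _ h := frontSol_le hα hα1 hp hκ hK fun _ hu =>
    (hu.1.antitone h).trans (le_frontSol hu _)
  nonneg t := le_frontSol (zero_mem_subsolutions hα hα1 hp hκ hK) t
  le t := frontSol_le hα hα1 hp hκ hK fun _ hu => hu.1.le t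

lemma frontSol_mem (hα : 0 < α) (hα1 : α < 1) (hp : 0 ≤ p) (hκ : 0 ≤ κ) (hK : 0 ≤ K) :
    frontSol α p κ K ∈ subsolutions α p κ K := by
  have hy := isProfile_frontSol hα hα1 hp hκ hK
  exact ⟨hy, fun t => frontSol_le hα hα1 hp hκ hK fun u hu => (hu.2 t).trans
    (frontOp_mono hα hα1 hp le_rfl hu.1 hy (le_frontSol hu) t)⟩

lemma frontSol_eq (hα : 0 < α) (hα1 : α < 1) (hp : 0 ≤ p) (hκ : 0 ≤ κ) (hK : 0 ≤ K)
    (hb : κ + K ^ p / Real.Gamma (2 - α) ≤ K) :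
    frontSol α p κ K = frontOp α p κ (frontSol α p κ K) := by
  obtain ⟨hy, hle⟩ := frontSol_mem hα hα1 hp hκ hK
  have hT := isProfile_frontOp hα hα1 hp hκ hy
  have hT' : IsProfile K (frontOp α p κ (frontSol α p κ K)) :=
    ⟨hT.antitone, hT.nonneg, fun t => (hT.le t).trans hb⟩
  exact funext fun t => (hle t).antisymm
    (le_frontSol ⟨hT', frontOp_mono hα hα1 hp le_rfl hy hT' hle⟩ t)

lemma frontSol_mono (hα : 0 < α) (hα1 : α < 1) (hp : 0 ≤ p) (hκ : 0 ≤ κ) (hK : 0 ≤ K) {κ' : ℝ}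
    (h : κ ≤ κ') (t : ℝ) : frontSol α p κ K t ≤ frontSol α p κ' K t :=
  frontSol_le hα hα1 hp hκ hK fun _ hu => le_frontSol
    ⟨hu.1, fun x => (hu.2 x).trans (frontOp_mono hα hα1 hp h hu.1 hu.1 (fun _ => le_rfl) x)⟩ t

lemma mul_frontSol_le (hα : 0 < α) (hα1 : α < 1) (hp : 0 ≤ p) (hp1 : p ≤ 1) (hκ : 0 ≤ κ)
    (hK : 0 ≤ K) {r : ℝ} (hr : 0 < r) (hr1 : r ≤ 1) (t : ℝ) :
    r * frontSol α p κ K t ≤ frontSol α p (r * κ) K t := by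
  obtain ⟨hy, hle⟩ := frontSol_mem hα hα1 hp hκ hK
  refine le_frontSol (u := fun x => r * frontSol α p κ K x) ⟨⟨fun a b h => ?_, fun x => ?_,
    fun x => ?_⟩, fun x => ?_⟩ t
  · exact mul_le_mul_of_nonneg_left (hy.antitone h) hr.le
  · exact mul_nonneg hr.le (hy.nonneg x)
  · nlinarith [hy.le x, hy.nonneg x]
  · exact (mul_le_mul_of_nonneg_left (hle x) hr.le).trans
      (mul_frontOp_le hα hα1 hp hp1 hr hr1 hy x)

lemma continuousOn_frontSol (hα : 0 < α) (hα1 : α < 1) (hp : 0 ≤ p) (hp1 : p ≤ 1) (hK : 0 ≤ K)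
    (t : ℝ) : ContinuousOn (fun κ => frontSol α p κ K t) (Ici 0) := by
  intro κ hκ
  rcases (show (0 : ℝ) ≤ κ from hκ).eq_or_lt with rfl | hκ0
  · rw [← continuousWithinAt_Ioi_iff_Ici]
    have hev : ∀ᶠ κ : ℝ in 𝓝[>] 0, 0 < κ := self_mem_nhdsWithin
    have hmono : ∀ t, MonotoneOn (fun κ => frontSol α p κ K t) (Ioi 0) := fun t κ hκ κ' _ h =>
      frontSol_mono hα hα1 hp (le_of_lt hκ) hK h t
    have hlim : ∀ t, Tendsto (fun κ => frontSol α p κ K t) (𝓝[>] 0)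
        (𝓝 (sInf ((fun κ => frontSol α p κ K t) '' Ioi 0))) := fun t =>
      (hmono t).tendsto_nhdsGT ⟨0, by
        rintro _ ⟨κ, hκ, rfl⟩
        exact (isProfile_frontSol hα hα1 hp (le_of_lt hκ) hK).nonneg t⟩
    set z : ℝ → ℝ := fun t => sInf ((fun κ => frontSol α p κ K t) '' Ioi 0)
    have hprof : ∀ᶠ κ : ℝ in 𝓝[>] 0, IsProfile K (frontSol α p κ K) :=
      hev.mono fun κ hκ => isProfile_frontSol hα hα1 hp (le_of_lt hκ) hK
    have hz : IsProfile K z :=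
      ⟨fun a b h => le_of_tendsto_of_tendsto (hlim b) (hlim a) (hprof.mono fun _ hy =>
        hy.antitone h), fun a => ge_of_tendsto (hlim a) (hprof.mono fun _ hy => hy.nonneg a),
        fun a => le_of_tendsto (hlim a) (hprof.mono fun _ hy => hy.le a)⟩
    have hT : ∀ t, Tendsto (fun κ => frontOp α p κ (frontSol α p κ K) t) (𝓝[>] 0)
        (𝓝 (frontOp α p 0 z t)) := fun t => by
      refine Tendsto.add ?_ (tendsto_integral_mul_EK hα1 hp hprof hlim (by fun_prop) _ _)
      exact (tendsto_id.mono_left nhdsWithin_le_nhds).mul_const _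
    have hzs : z ∈ subsolutions α p 0 K := ⟨hz, fun t => le_of_tendsto_of_tendsto (hlim t) (hT t)
      (hev.mono fun κ hκ => (frontSol_mem hα hα1 hp (le_of_lt hκ) hK).2 t)⟩
    have heq : z t = frontSol α p 0 K t := (le_frontSol hzs t).antisymm
      (ge_of_tendsto (hlim t) (hev.mono fun κ hκ => frontSol_mono hα hα1 hp le_rfl hK hκ.le t))
    rw [ContinuousWithinAt, ← heq]
    exact hlim t
  · refine ContinuousAt.continuousWithinAt ?_
    have hy : 0 ≤ frontSol α p κ K t := (isProfile_frontSol hα hα1 hp hκ hK).nonneg t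
    have hmin : Tendsto (fun κ' => min (κ' / κ) 1 * frontSol α p κ K t) (𝓝 κ)
        (𝓝 (frontSol α p κ K t)) := by
      have : Continuous fun κ' => min (κ' / κ) 1 * frontSol α p κ K t := by fun_prop
      simpa [hκ0.ne'] using this.tendsto κ
    have hmax : Tendsto (fun κ' => max (κ' / κ) 1 * frontSol α p κ K t) (𝓝 κ)
        (𝓝 (frontSol α p κ K t)) := by
      have : Continuous fun κ' => max (κ' / κ) 1 * frontSol α p κ K t := by fun_prop
      simpa [hκ0.ne'] using this.tendsto κ
    refine tendsto_of_tendsto_of_tendsto_of_le_of_le' hmin hmax ?_ ?_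
    · filter_upwards [lt_mem_nhds hκ0] with κ' hκ'
      rcases le_total κ' κ with h | h
      · have h1 : κ' / κ ≤ 1 := (div_le_one hκ0).2 h
        have := mul_frontSol_le hα hα1 hp hp1 hκ hK (div_pos hκ' hκ0) h1 t
        rwa [div_mul_cancel₀ _ hκ0.ne', ← min_eq_left h1] at this
      · rw [min_eq_right ((one_le_div hκ0).2 h), one_mul]
        exact frontSol_mono hα hα1 hp hκ hK h t
    · filter_upwards [lt_mem_nhds hκ0] with κ' hκ'
      rcases le_total κ' κ with h | h
      · rw [max_eq_right ((div_le_one hκ0).2 h), one_mul]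
        exact frontSol_mono hα hα1 hp hκ'.le hK h t
      · have h1 : κ / κ' ≤ 1 := (div_le_one hκ').2 h
        have := mul_frontSol_le hα hα1 hp hp1 hκ'.le hK (div_pos hκ0 hκ') h1 t
        rw [div_mul_cancel₀ _ hκ'.ne'] at this
        rw [max_eq_left ((one_le_div hκ0).2 h)]
        calc _ = κ' / κ * (κ / κ' * frontSol α p κ' K t) := by field_simp
          _ ≤ _ := by gcongr

end Sol

lemma sq_integral_le {D : ℝ} {V : ℝ → ℝ} (hV : IsProfile D V) :
    (∫ z in (0 : ℝ)..1, V z) ^ 2 ≤ 2 * D * ∫ z in (0 : ℝ)..1, z * V z := by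
  set L := ∫ z in (0 : ℝ)..1, V z with hL
  set M := ∫ z in (0 : ℝ)..1, z * V z with hM
  have hL0 : 0 ≤ L := intervalIntegral.integral_nonneg zero_le_one fun z _ => hV.nonneg z
  have hLD : L ≤ D := by
    calc L ≤ ∫ _ in (0 : ℝ)..1, D := intervalIntegral.integral_mono_on zero_le_one
          (hV.intervalIntegrable _ _) (by simp) fun z _ => hV.le z
      _ = D := by simp
  have key : ∀ l ∈ Icc (0 : ℝ) 1, l * L ≤ M + D * l ^ 2 / 2 := by
    intro l hl
    have hi : ∀ a b : ℝ, IntervalIntegrable (fun z => (z - l) * V z) volume a b :=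
      fun a b => hV.intervalIntegrable_mul (by fun_prop) a b
    have h1 : M - l * L = ∫ z in (0 : ℝ)..1, (z - l) * V z := by
      rw [hM, hL, ← intervalIntegral.integral_const_mul, ← intervalIntegral.integral_sub
        (hV.intervalIntegrable_mul (f := fun z => z) (by fun_prop) _ _)
        ((hV.intervalIntegrable _ _).const_mul _)]
      simp only [sub_mul]
    have h2 : 0 ≤ ∫ z in l..1, (z - l) * V z := intervalIntegral.integral_nonneg hl.2 fun z hz =>
      mul_nonneg (by linarith [hz.1]) (hV.nonneg z)
    have h3 : ∫ z in (0 : ℝ)..l, (z - l) * D ≤ ∫ z in (0 : ℝ)..l, (z - l) * V z :=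
      intervalIntegral.integral_mono_on hl.1 (Continuous.intervalIntegrable (by fun_prop) _ _)
        (hi _ _) fun z hz => mul_le_mul_of_nonpos_left (hV.le z) (by linarith [hz.2])
    have h4 : ∫ z in (0 : ℝ)..l, (z - l) * D = -(D * l ^ 2 / 2) := by
      rw [intervalIntegral.integral_mul_const, intervalIntegral.integral_sub (by simp) (by simp)]
      simp
      ring
    rw [← intervalIntegral.integral_add_adjacent_intervals (hi 0 l) (hi l 1)] at h1
    linarith
  rcases hV.nonneg_bound.eq_or_lt with h | h
  · have : L = 0 := by linarith
    simp [this, ← h]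
  · have := key (L / D) ⟨by positivity, (div_le_one h).2 hLD⟩
    have h5 := mul_le_mul_of_nonneg_left this h.le
    have h6 : D * (L / D * L) = L ^ 2 := by field_simp
    have h7 : D * (M + D * (L / D) ^ 2 / 2) = D * M + L ^ 2 / 2 := by field_simp
    linarith

lemma exists_frontOp_fixedPoint {α p τ : ℝ} (hα : 0 < α) (hα1 : α < 1) (hp : 0 ≤ p)
    (hp2 : p ≤ 1 / 2) (hτ : 2 * (1 - α / 2) ^ 2 / Real.Gamma (2 - α) ≤ τ) :
    ∃ κ K y, IsProfile K y ∧ frontOp α p κ y = y ∧ (∀ t < 1, 0 < y t) ∧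
      0 ≤ κ + (1 - α / 2) * ∫ z in (0 : ℝ)..1, EK α (fun t => y t ^ p) z ∧
      (κ + (1 - α / 2) * ∫ z in (0 : ℝ)..1, EK α (fun t => y t ^ p) z) ^ 2 =
        τ * y 0 ^ (1 + p) := by
  have hG : 0 < Real.Gamma (2 - α) := Real.Gamma_pos_of_pos (by linarith)
  have hc : 0 ≤ 1 - α / 2 := by linarith
  have hτ0 : 0 ≤ τ := le_trans (by positivity) hτ
  obtain ⟨D, hD1, hDG, hDτ⟩ : ∃ D : ℝ, 1 ≤ D ∧ 2 / Real.Gamma (2 - α) ≤ D ∧ 4 * τ ≤ D := by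
    have : 0 ≤ 2 / Real.Gamma (2 - α) := by positivity
    exact ⟨1 + 2 / Real.Gamma (2 - α) + 4 * τ, by linarith, by linarith, by linarith⟩
  set K := D ^ 2 with hKdef
  have hK : 0 < K := by positivity
  have hK1 : 1 ≤ K := one_le_pow₀ hD1
  have hsqrt : K ^ (1 / 2 : ℝ) = D := by
    rw [← Real.sqrt_eq_rpow, Real.sqrt_sq (by linarith)]
  have hKp : K ^ p ≤ D := hsqrt ▸ Real.rpow_le_rpow_of_exponent_le hK1 hp2
  have hbound : ∀ κ ≤ K / 2, κ + K ^ p / Real.Gamma (2 - α) ≤ K := by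
    intro κ hκ
    have : K ^ p / Real.Gamma (2 - α) ≤ K / 2 := by
      calc K ^ p / Real.Gamma (2 - α) ≤ D / Real.Gamma (2 - α) := by gcongr
        _ = D / 2 * (2 / Real.Gamma (2 - α)) := by field_simp
        _ ≤ D / 2 * D := by gcongr
        _ = K / 2 := by rw [hKdef]; ring
    linarith
  set y : ℝ → ℝ → ℝ := fun κ => frontSol α p κ K with hydef
  set N : ℝ → ℝ := fun κ => ∫ z in (0 : ℝ)..1, EK α (fun t => y κ t ^ p) z with hN
  have hprof : ∀ κ, 0 ≤ κ → IsProfile K (y κ) := fun κ hκ =>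
    isProfile_frontSol hα hα1 hp hκ hK.le
  have hN0 : ∀ κ, 0 ≤ κ → 0 ≤ N κ := fun κ hκ =>
    intervalIntegral.integral_nonneg zero_le_one fun z _ =>
      (isProfile_EK hα1 ((hprof κ hκ).rpow hp)).nonneg z
  have hcont : ContinuousOn
      (fun κ => (κ + (1 - α / 2) * N κ) ^ 2 - τ * y κ 0 ^ (1 + p)) (Icc 0 (K / 2)) := by
    have hy : ∀ t, ContinuousOn (fun κ => y κ t) (Icc 0 (K / 2)) := fun t =>
      (continuousOn_frontSol hα hα1 hp (by linarith) hK.le t).mono Icc_subset_Ici_self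
    have hNc : ContinuousOn N (Icc 0 (K / 2)) := fun κ hκ => by
      have := tendsto_integral_mul_EK (l := 𝓝[Icc 0 (K / 2)] κ) (f := fun _ => 1) hα1 hp
        (eventually_nhdsWithin_of_forall fun κ' hκ' => hprof κ' hκ'.1) (fun t => hy t κ hκ)
        continuous_const 0 1
      simp only [one_mul] at this
      exact this
    exact ((continuousOn_id.add (continuousOn_const.mul hNc)).pow 2).sub
      (continuousOn_const.mul ((hy 0).rpow_const fun _ _ => Or.inr (by linarith)))
  have heq : ∀ κ ∈ Icc 0 (K / 2), y κ = frontOp α p κ (y κ) := fun κ hκ =>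
    frontSol_eq hα hα1 hp hκ.1 hK.le (hbound κ hκ.2)
  have h0mem : (0 : ℝ) ∈ Icc 0 (K / 2) := ⟨le_rfl, by positivity⟩
  have hBmem : K / 2 ∈ Icc 0 (K / 2) := ⟨by positivity, le_rfl⟩
  have hle0 : (0 + (1 - α / 2) * N 0) ^ 2 - τ * y 0 0 ^ (1 + p) ≤ 0 := by
    have hy := hprof 0 le_rfl
    have ha := hy.nonneg 0
    have hy' : IsProfile (y 0 0) (y 0) := ⟨hy.antitone, hy.nonneg, fun t => by
      rcases le_total t 0 with h | h
      · rw [heq 0 h0mem]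
        exact (frontOp_apply_of_nonpos h).le
      · exact hy.antitone h⟩
    have h1 := sq_integral_le (isProfile_EK hα1 (hy'.rpow hp))
    have h2 : y 0 0 = ∫ z in (0 : ℝ)..1, z * EK α (fun t => y 0 t ^ p) z := by
      conv_lhs => rw [heq 0 h0mem, frontOp_apply_zero, zero_add]
    rw [← h2] at h1
    have h3 : y 0 0 ^ (1 + p) = y 0 0 * y 0 0 ^ p := by
      rw [Real.rpow_add_of_nonneg ha zero_le_one hp, Real.rpow_one]
    have h4 : 0 ≤ y 0 0 * y 0 0 ^ p := by positivity
    rw [h3, zero_add, mul_pow, sub_nonpos]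
    calc (1 - α / 2) ^ 2 * N 0 ^ 2
        ≤ (1 - α / 2) ^ 2 * (2 * (y 0 0 ^ p / Real.Gamma (2 - α)) * y 0 0) := by gcongr
      _ = 2 * (1 - α / 2) ^ 2 / Real.Gamma (2 - α) * (y 0 0 * y 0 0 ^ p) := by ring
      _ ≤ τ * (y 0 0 * y 0 0 ^ p) := by gcongr
  have hleB : 0 ≤ (K / 2 + (1 - α / 2) * N (K / 2)) ^ 2 - τ * y (K / 2) 0 ^ (1 + p) := by
    have hy := hprof (K / 2) hBmem.1
    have h1 : y (K / 2) 0 ^ (1 + p) ≤ K * D := by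
      calc y (K / 2) 0 ^ (1 + p) ≤ K ^ (1 + p) :=
            Real.rpow_le_rpow (hy.nonneg 0) (hy.le 0) (by linarith)
        _ = K * K ^ p := by rw [Real.rpow_add hK, Real.rpow_one]
        _ ≤ K * D := by gcongr
    have h2 : K / 2 ≤ K / 2 + (1 - α / 2) * N (K / 2) :=
      le_add_of_nonneg_right (mul_nonneg hc (hN0 _ hBmem.1))
    have h3 : (K / 2) ^ 2 ≤ (K / 2 + (1 - α / 2) * N (K / 2)) ^ 2 := by gcongr
    have h4 : τ * y (K / 2) 0 ^ (1 + p) ≤ D / 4 * (K * D) := by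
      refine mul_le_mul (by linarith) h1 (Real.rpow_nonneg (hy.nonneg 0) _) (by linarith)
    have h5 : D / 4 * (K * D) = (K / 2) ^ 2 := by rw [hKdef]; ring
    linarith
  obtain ⟨κ, hκ, hroot⟩ := intermediate_value_Icc hBmem.1 hcont ⟨hle0, hleB⟩
  obtain ⟨ε, hε, hεK, hsub⟩ := exists_bump_le_frontOp hα hα1 hp hp2 hK
  refine ⟨κ, K, y κ, hprof κ hκ.1, (heq κ hκ).symm, fun t ht => ?_,
    add_nonneg hκ.1 (mul_nonneg hc (hN0 κ hκ.1)), sub_eq_zero.1 hroot⟩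
  refine lt_of_lt_of_le ?_ (le_frontSol ⟨isProfile_bump hε.le hεK, hsub κ hκ.1⟩ t)
  have : clamp t < 1 := max_lt one_pos ((min_le_left _ _).trans_lt ht)
  have : 0 < 1 - clamp t := by linarith
  positivity

lemma frontOp_apply_of_mem {α p κ K x : ℝ} {y : ℝ → ℝ} (hα1 : α < 1) (hp : 0 ≤ p)
    (hy : IsProfile K y) (hx : x ∈ Icc (0 : ℝ) 1) :
    frontOp α p κ y x = frontOp α p κ y 0 -
      x * (κ + (1 - α / 2) * ∫ z in (0 : ℝ)..1, EK α (fun t => y t ^ p) z) +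
      ∫ z in (0 : ℝ)..x, ((1 - α / 2) * x - z) * EK α (fun t => y t ^ p) z := by
  have hV := isProfile_EK hα1 (hy.rpow hp)
  have h1 : ∫ z in (0 : ℝ)..x, ((1 - α / 2) * x - z) * EK α (fun t => y t ^ p) z =
      -∫ z in (0 : ℝ)..x, (z - (1 - α / 2) * x) * EK α (fun t => y t ^ p) z := by
    rw [← intervalIntegral.integral_neg]
    congr 1
    funext z
    ring
  have h2 := intervalIntegral.integral_add_adjacent_intervals
    (hV.intervalIntegrable_mul (f := fun z => z - (1 - α / 2) * x) (by fun_prop) 0 x)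
    (hV.intervalIntegrable_mul (f := fun z => z - (1 - α / 2) * x) (by fun_prop) x 1)
  have h3 : ∫ z in (0 : ℝ)..1, (z - (1 - α / 2) * x) * EK α (fun t => y t ^ p) z =
      (∫ z in (0 : ℝ)..1, z * EK α (fun t => y t ^ p) z) -
        (1 - α / 2) * x * ∫ z in (0 : ℝ)..1, EK α (fun t => y t ^ p) z := by
    rw [← intervalIntegral.integral_const_mul, ← intervalIntegral.integral_sub
      (hV.intervalIntegrable_mul (f := fun z => z) (by fun_prop) _ _)
        ((hV.intervalIntegrable _ _).const_mul _)]
    simp only [sub_mul]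
  rw [frontOp_apply_zero, frontOp, clamp_of_mem hx, h1]
  linarith

lemma integral_kernel_le {α D η : ℝ} {V : ℝ → ℝ} (hα : 0 < α) (hα1 : α < 1) (hη : 0 ≤ η)
    (hV : IsProfile D V) :
    ∫ z in (0 : ℝ)..η, ((1 - α / 2) * η - z) * V z ≤ D * ((2 - α) ^ 2 * η ^ 2 / 8) := by
  have hi : ∀ a b : ℝ, IntervalIntegrable (fun z => ((1 - α / 2) * η - z) * V z) volume a b :=
    fun a b => hV.intervalIntegrable_mul (by fun_prop) a b
  have h0 : 0 ≤ (1 - α / 2) * η := mul_nonneg (by linarith) hη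
  have h1 : (1 - α / 2) * η ≤ η := by nlinarith
  rw [← intervalIntegral.integral_add_adjacent_intervals (hi 0 ((1 - α / 2) * η)) (hi _ η)]
  refine (add_le_of_nonpos_right ?_).trans ((intervalIntegral.integral_mono_on h0 (hi _ _)
    (Continuous.intervalIntegrable (u := fun z => ((1 - α / 2) * η - z) * D) (by fun_prop) _ _)
    fun z hz => mul_le_mul_of_nonneg_left (hV.le z) (by linarith [hz.2])).trans_eq ?_)
  · simpa using intervalIntegral.integral_mono_on (g := fun _ => 0) h1 (hi _ _) (by simp)
      fun z hz => mul_nonpos_of_nonpos_of_nonneg (by linarith [hz.1]) (hV.nonneg z)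
  · rw [intervalIntegral.integral_mul_const, intervalIntegral.integral_sub (by simp) (by simp)]
    simp
    ring

lemma le_integral_kernel {α D η : ℝ} {V : ℝ → ℝ} (hα : 0 < α) (hα1 : α < 1) (hη : 0 ≤ η)
    (hV : IsProfile D V) :
    -(D * (α ^ 2 * η ^ 2 / 8)) ≤ ∫ z in (0 : ℝ)..η, ((1 - α / 2) * η - z) * V z := by
  have hi : ∀ a b : ℝ, IntervalIntegrable (fun z => ((1 - α / 2) * η - z) * V z) volume a b :=
    fun a b => hV.intervalIntegrable_mul (by fun_prop) a b
  have h0 : 0 ≤ (1 - α / 2) * η := mul_nonneg (by linarith) hη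
  have h1 : (1 - α / 2) * η ≤ η := by nlinarith
  rw [← intervalIntegral.integral_add_adjacent_intervals (hi 0 ((1 - α / 2) * η)) (hi _ η)]
  refine le_add_of_nonneg_of_le ?_ (le_trans (le_of_eq ?_)
    (intervalIntegral.integral_mono_on h1
    (Continuous.intervalIntegrable (u := fun z => ((1 - α / 2) * η - z) * D) (by fun_prop) _ _)
    (hi _ _) fun z hz => mul_le_mul_of_nonpos_left (hV.le z) (by linarith [hz.1])))
  · exact intervalIntegral.integral_nonneg h0 fun z hz =>
      mul_nonneg (by linarith [hz.2]) (hV.nonneg z)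
  · rw [intervalIntegral.integral_mul_const, intervalIntegral.integral_sub (by simp) (by simp)]
    simp
    ring

lemma le_sq_of_slope_le {α m β : ℝ} (hα1 : α < 1) (hm : 1 < m)
    (hβ : β ≥ (2 - α) / Real.sqrt (2 * Real.Gamma (2 - α) * (m + 1))) :
    0 < β ∧ (2 - α) ^ 2 ≤ 2 * Real.Gamma (2 - α) * (m + 1) * β ^ 2 := by
  have hG : 0 < Real.Gamma (2 - α) := Real.Gamma_pos_of_pos (by linarith)
  have hX : 0 < 2 * Real.Gamma (2 - α) * (m + 1) := by positivity
  have hα2 : 0 < 2 - α := by linarith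
  have hs := Real.sqrt_pos.2 hX
  refine ⟨lt_of_lt_of_le (by positivity) hβ, ?_⟩
  have h : 2 - α ≤ β * Real.sqrt (2 * Real.Gamma (2 - α) * (m + 1)) := (div_le_iff₀ hs).1 hβ
  calc (2 - α) ^ 2 ≤ (β * Real.sqrt (2 * Real.Gamma (2 - α) * (m + 1))) ^ 2 := by gcongr
    _ = _ := by rw [mul_pow, Real.sq_sqrt hX.le]; ring

lemma eta1_nonneg_and_isRoot {α m β : ℝ} (hα1 : α < 1) (hm : 1 < m) (hβ : 0 < β)
    (h : (2 - α) ^ 2 ≤ 2 * Real.Gamma (2 - α) * (m + 1) * β ^ 2) :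
    0 ≤ eta1 α m β ∧ 1 + (m + 1) * (-(β * eta1 α m β) +
      1 / Real.Gamma (2 - α) * ((2 - α) ^ 2 * eta1 α m β ^ 2 / 8)) = 0 := by
  have hG : 0 < Real.Gamma (2 - α) := Real.Gamma_pos_of_pos (by linarith)
  have hα2 : 0 < 2 - α := by linarith
  have hm1 : 0 < m + 1 := by linarith
  have hG3 : Real.Gamma (3 - α) = (2 - α) * Real.Gamma (2 - α) := by
    rw [← Real.Gamma_add_one hα2.ne']; congr 1; ring
  rw [eta1, hG3]
  set G := Real.Gamma (2 - α)
  set A := 4 * β * G / (2 - α) ^ 2 with hA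
  set X := 2 * √2 / ((2 - α) ^ 2 * √(m + 1)) *
    √(2 * β ^ 2 * (m + 1) * G ^ 2 - (2 - α) * ((2 - α) * G)) with hX
  have hd : 0 ≤ 2 * β ^ 2 * (m + 1) * G ^ 2 - (2 - α) * ((2 - α) * G) := by
    nlinarith [mul_le_mul_of_nonneg_right h hG.le]
  have hX2 : X ^ 2 = A ^ 2 - 8 * G / ((2 - α) ^ 2 * (m + 1)) := by
    rw [hX, mul_pow, Real.sq_sqrt hd, div_pow, mul_pow, mul_pow, Real.sq_sqrt hm1.le,
      Real.sq_sqrt zero_le_two, hA]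
    field_simp
    ring
  have hA0 : 0 ≤ A := by positivity
  have hX0 : 0 ≤ X := by positivity
  constructor
  · have : X ^ 2 ≤ A ^ 2 := by
      rw [hX2]
      exact sub_le_self _ (by positivity)
    exact sub_nonneg.2 ((pow_le_pow_iff_left₀ hX0 hA0 two_ne_zero).1 this)
  · have hβA : β = A * (2 - α) ^ 2 / (4 * G) := by rw [hA]; field_simp
    have : 1 + (m + 1) * (-(β * (A - X)) + 1 / G * ((2 - α) ^ 2 * (A - X) ^ 2 / 8)) =
        1 + (m + 1) * ((2 - α) ^ 2 / (8 * G)) * (X ^ 2 - A ^ 2) := by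
      rw [hβA]
      field_simp
      ring
    rw [this, hX2]
    field_simp
    ring

lemma eta2_le {α m β μ : ℝ} (hα : 0 < α) (hα1 : α < 1) (hm : 1 < m) (hβ : 0 < β) (hμ : 0 ≤ μ)
    (h : 1 + (m + 1) * (-(β * μ) + -(1 / Real.Gamma (2 - α) * (α ^ 2 * μ ^ 2 / 8))) ≤ 0) :
    eta2 α m β ≤ μ := by
  have hG : 0 < Real.Gamma (2 - α) := Real.Gamma_pos_of_pos (by linarith)
  have hm1 : 0 < m + 1 := by linarith
  rw [eta2]
  set G := Real.Gamma (2 - α)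
  set A := 4 * β * G / α ^ 2 with hA
  set X := 2 * √2 * √(G * (α ^ 2 + 2 * β ^ 2 * (m + 1) * G)) / (α ^ 2 * √(m + 1)) with hX
  have hX2 : X ^ 2 = A ^ 2 + 8 * G / (α ^ 2 * (m + 1)) := by
    rw [hX, div_pow, mul_pow, mul_pow, mul_pow, Real.sq_sqrt zero_le_two,
      Real.sq_sqrt hm1.le, Real.sq_sqrt (by positivity), hA]
    field_simp
    ring
  have hA0 : 0 ≤ A := by positivity
  have hX0 : 0 ≤ X := by positivity
  rw [sub_le_iff_le_add]
  refine (pow_le_pow_iff_left₀ hX0 (by positivity) two_ne_zero).1 ?_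
  have key : (μ + A) ^ 2 - X ^ 2 = 8 * G / (α ^ 2 * (m + 1)) *
      -(1 + (m + 1) * (-(β * μ) + -(1 / G * (α ^ 2 * μ ^ 2 / 8)))) := by
    rw [hX2, hA]
    field_simp
    ring
  have : 0 ≤ (μ + A) ^ 2 - X ^ 2 := by
    rw [key]
    exact mul_nonneg (by positivity) (by linarith)
  linarith

/-- Rescaling a fixed point of the front operator to one with value `1` at the origin. -/
lemma exists_rescaled {α m β : ℝ} (hα : 0 < α) (hα1 : α < 1) (hm : 1 < m) (hβ0 : 0 < β)
    (hβ : (2 - α) ^ 2 ≤ 2 * Real.Gamma (2 - α) * (m + 1) * β ^ 2) :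
    ∃ (Y : ℝ → ℝ) (μ : ℝ), IsProfile 1 Y ∧ Continuous Y ∧ Y 0 = 1 ∧ 0 < μ ∧
      (∀ t < μ, 0 < Y t) ∧ (∀ t, μ ≤ t → Y t = 0) ∧
      ∀ η ∈ Icc (0 : ℝ) μ, Y η = 1 + (m + 1) * (-(β * η) +
        ∫ z in (0 : ℝ)..η, ((1 - α / 2) * η - z) * EK α (fun t => Y t ^ (1 / (1 + m))) z) := by
  have hG : 0 < Real.Gamma (2 - α) := Real.Gamma_pos_of_pos (by linarith)
  have hm1 : 0 < m + 1 := by linarith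
  set p := 1 / (1 + m) with hpdef
  have hp : 0 ≤ p := by positivity
  have hp2 : p ≤ 1 / 2 := by
    rw [hpdef]
    exact one_div_le_one_div_of_le two_pos (by linarith)
  have hτ : 2 * (1 - α / 2) ^ 2 / Real.Gamma (2 - α) ≤ β ^ 2 * (m + 1) := by
    rw [div_le_iff₀ hG]
    nlinarith
  obtain ⟨κ, K, y, hy, hfix, hpos, hb0, hb⟩ := exists_frontOp_fixedPoint hα hα1 hp hp2 hτ
  have hexp := fun x (hx : x ∈ Icc (0 : ℝ) 1) =>
    frontOp_apply_of_mem (α := α) (κ := κ) hα1 hp hy hx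
  rw [hfix] at hexp
  set b := κ + (1 - α / 2) * ∫ z in (0 : ℝ)..1, EK α (fun t => y t ^ p) z
  have ha : 0 < y 0 := hpos 0 one_pos
  have hle : ∀ t, y t ≤ y 0 := fun t => by
    rcases le_total t 0 with h | h
    · rw [← hfix]
      exact (frontOp_apply_of_nonpos h).le
    · exact hy.antitone h
  rw [Real.rpow_add ha, Real.rpow_one] at hb
  have hq : 0 < y 0 ^ p := Real.rpow_pos_of_pos ha p
  set a := y 0 with hadef
  set q := a ^ p with hqdef
  have hμ : 0 < √(q / (a * (m + 1))) := by positivity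
  have hμ2 : √(q / (a * (m + 1))) ^ 2 = q / (a * (m + 1)) := Real.sq_sqrt (by positivity)
  set μ := √(q / (a * (m + 1)))
  have hslope : a⁻¹ * b = (m + 1) * β * μ := by
    refine (pow_left_inj₀ (by positivity) (by positivity) two_ne_zero).1 ?_
    rw [mul_pow, mul_pow, hμ2, hb]
    field_simp
  have hEK : ∀ z, EK α (fun t => (a⁻¹ * y (t / μ)) ^ p) z =
      q⁻¹ * EK α (fun t => y t ^ p) (z / μ) := fun z => by
    rw [← EK_comp_div α μ (fun t => y t ^ p), ← EK_const_mul]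
    simp only [Real.mul_rpow (inv_nonneg.2 ha.le) (hy.nonneg _), Real.inv_rpow ha.le, hqdef]
  refine ⟨fun t => a⁻¹ * y (t / μ), μ, ⟨fun s t h => ?_, fun t => ?_, fun t => ?_⟩, ?_, ?_, hμ,
    fun t ht => ?_, fun t ht => ?_, fun η hη => ?_⟩
  · exact mul_le_mul_of_nonneg_left (hy.antitone (by gcongr)) (by positivity)
  · exact mul_nonneg (by positivity) (hy.nonneg _)
  · exact (inv_mul_le_iff₀ ha).2 (by simpa using hle _)
  · have : Continuous y := hfix ▸ continuous_frontOp hα1 hp hy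
    fun_prop
  · simp [← hadef, ha.ne']
  · exact mul_pos (by positivity) (hpos _ ((div_lt_one hμ).2 ht))
  · dsimp only
    rw [← hfix, frontOp_apply_of_one_le ((one_le_div hμ).2 ht), mul_zero]
  · have hint : ∫ z in (0 : ℝ)..η, ((1 - α / 2) * η - z) *
        EK α (fun t => (a⁻¹ * y (t / μ)) ^ p) z = q⁻¹ * μ ^ 2 * ∫ z in (0 : ℝ)..(η / μ),
          ((1 - α / 2) * (η / μ) - z) * EK α (fun t => y t ^ p) z := by
      have := intervalIntegral.integral_comp_div (a := 0) (b := η) (c := μ) (fun z =>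
        ((1 - α / 2) * (η / μ) - z) * EK α (fun t => y t ^ p) z) hμ.ne'
      rw [zero_div, smul_eq_mul] at this
      rw [pow_two, ← mul_assoc, mul_assoc (q⁻¹ * μ), ← this,
        ← intervalIntegral.integral_const_mul]
      congr 1
      funext z
      rw [hEK]
      field_simp
    dsimp only
    rw [hint, hexp (η / μ) ⟨div_nonneg hη.1 hμ.le, (div_le_one hμ).2 hη.2⟩, mul_add, mul_sub,
      mul_left_comm a⁻¹ (η / μ), hslope, hμ2]
    field_simp
    ring

end ErdelyiKober

/-- Main existence theorem: for β ≥ β₀ there is a continuous,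
[0,1]-valued, compactly supported fixed point Y of the truncated operator, with
supp Y = [0, η*(β)] for some η*(β) ∈ [η₂(β), η₁(β)]. -/
theorem main_existence (α m β : ℝ) (hα : 0 < α) (hα1 : α < 1) (hm : 1 < m)
    (hβ : β ≥ (2 - α) / Real.sqrt (2 * Real.Gamma (2 - α) * (m + 1))) :
    ∃ Y : ℝ → ℝ, Continuous Y ∧ (∀ t, 0 ≤ Y t ∧ Y t ≤ 1) ∧ Y 0 = 1 ∧
      ∃ ηs ∈ Set.Icc (eta2 α m β) (eta1 α m β),
        (∀ η ∈ Set.Icc (0:ℝ) ηs,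
          Y η = 1 + (m + 1) * (-(β * η) +
            ∫ z in (0:ℝ)..η, ((1 - α / 2) * η - z) *
              EK α (fun t => Y t ^ (1 / (1 + m))) z)) ∧
        (∀ η, ηs < η → Y η = 0) ∧
        closure {η | 0 ≤ η ∧ Y η ≠ 0} = Set.Icc 0 ηs := by
  open ErdelyiKober Set in
  obtain ⟨hβ0, hβ2⟩ := le_sq_of_slope_le hα1 hm hβ
  obtain ⟨Y, μ, hY, hcont, hY0, hμ, hpos, hzero, heq⟩ := exists_rescaled hα hα1 hm hβ0 hβ2
  have hV := isProfile_EK hα1 (hY.rpow (p := 1 / (1 + m)) (by positivity))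
  rw [Real.one_rpow] at hV
  have hm1 : 0 ≤ m + 1 := by linarith
  refine ⟨Y, hcont, fun t => ⟨hY.nonneg t, hY.le t⟩, hY0, μ, ⟨?_, ?_⟩, heq,
    fun η hη => hzero η hη.le, ?_⟩
  · refine eta2_le hα hα1 hm hβ0 hμ.le ?_
    calc _ ≤ Y μ := by
          rw [heq μ ⟨hμ.le, le_rfl⟩]
          gcongr
          exact le_integral_kernel hα hα1 hμ.le hV
      _ = 0 := hzero μ le_rfl
  · obtain ⟨h0, hroot⟩ := eta1_nonneg_and_isRoot hα1 hm hβ0 hβ2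
    by_contra! hlt
    have hle : Y (eta1 α m β) ≤ 0 := by
      rw [heq _ ⟨h0, hlt.le⟩]
      refine le_trans ?_ hroot.le
      gcongr
      exact integral_kernel_le hα hα1 h0 hV
    exact (hpos _ hlt).not_ge hle
  · have : {η | 0 ≤ η ∧ Y η ≠ 0} = Ico 0 μ := by
      ext η
      refine ⟨fun h => ⟨h.1, not_le.1 fun hle => h.2 (hzero η hle)⟩,
        fun h => ⟨h.1, (hpos η h.2).ne'⟩⟩
    rw [this, closure_Ico hμ.ne]
end
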